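/- arXiv:2111.10366 — 5 statements merged into one kernel-verified Lean document; each statement's English description precedes it below -/
import Mathlib

section
/- Let F be a graph, A a nonempty vertex subset of F, and λ ≥ 2 a real number. If there exists ℓ₀ ∈ ℕ such that the path extension satisfies λ₁((F, A, ℓ)) < −λ for every ℓ ≥ ℓ₀, then there exists m ∈ ℕ⁺ such that the path-clique extensions satisfy λ₁((F, A, ℓ, K_m)) < −λ for every ℓ ∈ ℕ. -/
open Classical

/-- An eigenvalue of a real matrix indexed by a finite type. -/
def IsEigenvalue {V : Type*} [Fintype V] (A : Matrix V V ℝ) (μ : ℝ) : Prop :=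
  ∃ v : V → ℝ, v ≠ 0 ∧ A.mulVec v = μ • v

/-- The adjacency matrix (over ℝ) of a simple graph. -/
noncomputable def adjMat {V : Type*} [Fintype V] (G : SimpleGraph V) : Matrix V V ℝ :=
  fun i j => if G.Adj i j then 1 else 0

/-- The smallest eigenvalue of a real matrix. -/
noncomputable def minEig {V : Type*} [Fintype V] (A : Matrix V V ℝ) : ℝ :=
  sInf {μ : ℝ | IsEigenvalue A μ}

/-- The path extension `(F, A, ℓ)`: add a new path `v₀ v₁ ⋯ v_ℓ` and join `v₀` to every
vertex of `A`. -/
def pathExt {V : Type*} (F : SimpleGraph V) (A : Set V) (ℓ : ℕ) :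
    SimpleGraph (V ⊕ Fin (ℓ + 1)) :=
  SimpleGraph.fromRel fun x y =>
    match x, y with
    | Sum.inl u, Sum.inl v => F.Adj u v
    | Sum.inl u, Sum.inr i => u ∈ A ∧ i = 0
    | Sum.inr i, Sum.inr j => (j : ℕ) = (i : ℕ) + 1
    | _, _ => False

/-- The path-clique extension `(F, A, ℓ, K_m)`: the path extension `(F, A, ℓ)` together with
a clique on `m` new vertices, each joined to `v_ℓ`. -/
def pathCliqueExt {V : Type*} (F : SimpleGraph V) (A : Set V) (ℓ m : ℕ) :
    SimpleGraph ((V ⊕ Fin (ℓ + 1)) ⊕ Fin m) :=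
  SimpleGraph.fromRel fun x y =>
    match x, y with
    | Sum.inl a, Sum.inl b => (pathExt F A ℓ).Adj a b
    | Sum.inl (Sum.inr i), Sum.inr _ => (i : ℕ) = ℓ
    | Sum.inr a, Sum.inr b => a ≠ b
    | _, _ => False

open Matrix in
theorem minEig_lt_of_dotProduct_mulVec_neg {V : Type*} [Fintype V] {M : Matrix V V ℝ}
    (hM : M.IsHermitian) {c : ℝ} {x : V → ℝ} (hx : x ⬝ᵥ M *ᵥ x + c * (x ⬝ᵥ x) < 0) :
    minEig M < -c := by
  have hN : (M + c • (1 : Matrix V V ℝ)).IsHermitian := by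
    refine hM.add ?_
    rw [IsHermitian, conjTranspose_smul, conjTranspose_one, star_trivial]
  have hnot : ¬ (M + c • (1 : Matrix V V ℝ)).PosSemidef := by
    intro hp
    have h0 := hp.dotProduct_mulVec_nonneg x
    simp only [star_trivial, add_mulVec, smul_mulVec, one_mulVec, dotProduct_add,
      dotProduct_smul, smul_eq_mul] at h0
    linarith
  rw [hN.posSemidef_iff_eigenvalues_nonneg, Pi.le_def] at hnot
  push Not at hnot
  obtain ⟨i, hi⟩ := hnot
  have hev := hN.mulVec_eigenvectorBasis i
  have hmem : IsEigenvalue M (hN.eigenvalues i - c) := by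
    refine ⟨(hN.eigenvectorBasis i).ofLp, ?_, ?_⟩
    · intro h0
      exact hN.eigenvectorBasis.orthonormal.ne_zero i (WithLp.ofLp_injective 2 h0)
    · rw [add_mulVec, smul_mulVec, one_mulVec] at hev
      rw [sub_smul, ← hev, add_sub_cancel_right]
  have hfin : {μ : ℝ | IsEigenvalue M μ}.Finite := by
    refine (Module.End.finite_hasEigenvalue (Matrix.toLin' M)).subset ?_
    rintro μ ⟨v, hv, hMv⟩
    exact Module.End.hasEigenvalue_of_hasEigenvector
      (Module.End.hasEigenvector_iff.2 ⟨Module.End.mem_eigenspace_iff.2 (by simpa using hMv), hv⟩)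
  have hle : minEig M ≤ hN.eigenvalues i - c := csInf_le hfin.bddBelow hmem
  have hneg : hN.eigenvalues i < 0 := hi
  linarith

open Matrix in
theorem exists_dotProduct_mulVec_neg_of_minEig_lt {V : Type*} [Fintype V] {M : Matrix V V ℝ}
    {c : ℝ} (hc : 0 ≤ c) (h : minEig M < -c) :
    ∃ x : V → ℝ, x ⬝ᵥ M *ᵥ x + c * (x ⬝ᵥ x) < 0 := by
  have hne : {μ : ℝ | IsEigenvalue M μ}.Nonempty := by
    by_contra hemp
    rw [Set.not_nonempty_iff_eq_empty] at hemp
    rw [minEig, hemp, Real.sInf_empty] at h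
    linarith
  obtain ⟨μ, ⟨v, hv, hMv⟩, hμ⟩ := exists_lt_of_csInf_lt hne h
  refine ⟨v, ?_⟩
  have hpos : 0 < v ⬝ᵥ v := by
    simpa using dotProduct_star_self_pos_iff.2 hv
  rw [hMv, dotProduct_smul, smul_eq_mul]
  nlinarith

theorem isHermitian_adjMat {V : Type*} [Fintype V] (G : SimpleGraph V) :
    (adjMat G).IsHermitian := by
  ext i j
  simp [adjMat, G.adj_comm]

/-- The quadratic form of `adjMat G + c • 1`. -/
noncomputable def shiftedForm {V : Type*} [Fintype V] (G : SimpleGraph V) (c : ℝ)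
    (x : V → ℝ) : ℝ :=
  (∑ i, ∑ j, if G.Adj i j then x i * x j else 0) + c * ∑ i, x i ^ 2

open Matrix in
theorem shiftedForm_eq_dotProduct {V : Type*} [Fintype V] (G : SimpleGraph V) (c : ℝ)
    (x : V → ℝ) : shiftedForm G c x = x ⬝ᵥ adjMat G *ᵥ x + c * (x ⬝ᵥ x) := by
  simp only [shiftedForm, dotProduct, mulVec, adjMat, Finset.mul_sum, pow_two]
  congr 1
  refine Finset.sum_congr rfl fun i _ => Finset.sum_congr rfl fun j _ => ?_
  split_ifs <;> simp

theorem minEig_adjMat_lt_iff {V : Type*} [Fintype V] (G : SimpleGraph V) {c : ℝ}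
    (hc : 0 ≤ c) : minEig (adjMat G) < -c ↔ ∃ x, shiftedForm G c x < 0 := by
  simp only [shiftedForm_eq_dotProduct]
  exact ⟨exists_dotProduct_mulVec_neg_of_minEig_lt hc,
    fun ⟨_, hx⟩ => minEig_lt_of_dotProduct_mulVec_neg (isHermitian_adjMat G) hx⟩

section Adjacency

variable {V : Type*} (F : SimpleGraph V) (A : Set V)

theorem pathExt_adj_inl_inl (ℓ : ℕ) (u v : V) :
    (pathExt F A ℓ).Adj (Sum.inl u) (Sum.inl v) ↔ F.Adj u v := by
  simp only [pathExt, SimpleGraph.fromRel_adj, ne_eq, Sum.inl.injEq, F.adj_comm v u, or_self]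
  exact ⟨fun h => h.2, fun h => ⟨h.ne, h⟩⟩

theorem pathExt_adj_inl_inr (ℓ : ℕ) (u : V) (i : Fin (ℓ + 1)) :
    (pathExt F A ℓ).Adj (Sum.inl u) (Sum.inr i) ↔ u ∈ A ∧ i = 0 := by
  simp [pathExt, SimpleGraph.fromRel_adj]

theorem pathExt_adj_inr_inr (ℓ : ℕ) (i j : Fin (ℓ + 1)) :
    (pathExt F A ℓ).Adj (Sum.inr i) (Sum.inr j) ↔
      (j : ℕ) = (i : ℕ) + 1 ∨ (i : ℕ) = (j : ℕ) + 1 := by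
  simp only [pathExt, SimpleGraph.fromRel_adj, ne_eq, Sum.inr.injEq, Fin.ext_iff]
  omega

theorem pathExt_adj_inr_inl (ℓ : ℕ) (u : V) (i : Fin (ℓ + 1)) :
    (pathExt F A ℓ).Adj (Sum.inr i) (Sum.inl u) ↔ u ∈ A ∧ i = 0 := by
  rw [SimpleGraph.adj_comm, pathExt_adj_inl_inr]

theorem pathCliqueExt_adj_inl_inl (ℓ m : ℕ) (a b : V ⊕ Fin (ℓ + 1)) :
    (pathCliqueExt F A ℓ m).Adj (Sum.inl a) (Sum.inl b) ↔ (pathExt F A ℓ).Adj a b := by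
  simp only [pathCliqueExt, SimpleGraph.fromRel_adj, ne_eq, Sum.inl.injEq,
    (pathExt F A ℓ).adj_comm b a, or_self]
  exact ⟨fun h => h.2, fun h => ⟨h.ne, h⟩⟩

theorem pathCliqueExt_adj_inl_inr (ℓ m : ℕ) (a : V ⊕ Fin (ℓ + 1)) (k : Fin m) :
    (pathCliqueExt F A ℓ m).Adj (Sum.inl a) (Sum.inr k) ↔ a = Sum.inr (Fin.last ℓ) := by
  rcases a with u | i <;> simp [pathCliqueExt, SimpleGraph.fromRel_adj, Fin.ext_iff]

theorem pathCliqueExt_adj_inr_inl (ℓ m : ℕ) (a : V ⊕ Fin (ℓ + 1)) (k : Fin m) :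
    (pathCliqueExt F A ℓ m).Adj (Sum.inr k) (Sum.inl a) ↔ a = Sum.inr (Fin.last ℓ) := by
  rw [SimpleGraph.adj_comm, pathCliqueExt_adj_inl_inr]

theorem pathCliqueExt_adj_inr_inr (ℓ m : ℕ) (j k : Fin m) :
    (pathCliqueExt F A ℓ m).Adj (Sum.inr j) (Sum.inr k) ↔ j ≠ k := by
  simp [pathCliqueExt, SimpleGraph.fromRel_adj, eq_comm]

end Adjacency

/-- The form on a path-clique extension, at a vector that is constant on the clique. -/
theorem shiftedForm_pathCliqueExt {V : Type*} [Fintype V] (F : SimpleGraph V) (A : Set V)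
    (ℓ m : ℕ) (c t : ℝ) (x : V ⊕ Fin (ℓ + 1) → ℝ) :
    shiftedForm (pathCliqueExt F A ℓ m) c (Sum.elim x fun _ => t) =
      shiftedForm (pathExt F A ℓ) c x + 2 * (m * t) * x (Sum.inr (Fin.last ℓ))
        + m * (m - 1) * t ^ 2 + c * (m * t ^ 2) := by
  have hclique : ∑ j : Fin m, ∑ k : Fin m, (if j ≠ k then t * t else 0)
      = m * (m - 1) * t ^ 2 := by
    have hrow (j : Fin m) : ∑ k : Fin m, (if j ≠ k then t * t else 0) = (m - 1) * t ^ 2 := by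
      have hsub (k : Fin m) : (if j ≠ k then t * t else 0) = t * t - if j = k then t * t else 0 := by
        split_ifs <;> simp_all
      simp only [hsub, Finset.sum_sub_distrib, Finset.sum_ite_eq, Finset.mem_univ, if_true,
        Finset.sum_const, Finset.card_univ, Fintype.card_fin, nsmul_eq_mul]
      ring
    simp only [hrow, Finset.sum_const, Finset.card_univ, Fintype.card_fin, nsmul_eq_mul]
    ring
  have hsplit (f : (V ⊕ Fin (ℓ + 1)) ⊕ Fin m → ℝ) :
      ∑ i, f i = ∑ a, f (Sum.inl a) + ∑ k, f (Sum.inr k) := Fintype.sum_sum_type f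
  simp only [shiftedForm, hsplit, pathCliqueExt_adj_inl_inl, pathCliqueExt_adj_inl_inr,
    pathCliqueExt_adj_inr_inl, pathCliqueExt_adj_inr_inr, Sum.elim_inl, Sum.elim_inr,
    Finset.sum_add_distrib, hclique]
  rw [Finset.sum_comm (s := (Finset.univ : Finset (V ⊕ Fin (ℓ + 1))))
    (t := (Finset.univ : Finset (Fin m)))]
  simp only [Finset.sum_ite_eq', Finset.mem_univ, if_true, Finset.sum_const, Finset.card_univ,
    Fintype.card_fin, nsmul_eq_mul]
  ring

/-- Deleting the last vertex of a path extension. -/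
theorem shiftedForm_pathExt_succ {V : Type*} [Fintype V] (F : SimpleGraph V) (A : Set V)
    (ℓ : ℕ) (c : ℝ) (x : V ⊕ Fin (ℓ + 2) → ℝ) :
    shiftedForm (pathExt F A (ℓ + 1)) c x =
      shiftedForm (pathExt F A ℓ) c (x ∘ Sum.map id Fin.castSucc)
        + 2 * x (Sum.inr (Fin.last ℓ).castSucc) * x (Sum.inr (Fin.last (ℓ + 1)))
        + c * x (Sum.inr (Fin.last (ℓ + 1))) ^ 2 := by
  have hlast (i : Fin (ℓ + 1)) : ((ℓ + 1 = (i : ℕ) + 1 ∨ (i : ℕ) = ℓ + 1 + 1) ↔ i = Fin.last ℓ) := by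
    rw [Fin.ext_iff, Fin.val_last]; omega
  have hlast' (i : Fin (ℓ + 1)) : (((i : ℕ) = ℓ + 1 + 1 ∨ ℓ + 1 = (i : ℕ) + 1) ↔ i = Fin.last ℓ) := by
    rw [or_comm, hlast]
  have hz : ¬ ((ℓ + 1 = ℓ + 1 + 1) ∨ (ℓ + 1 = ℓ + 1 + 1)) := by omega
  have hzero (i : Fin (ℓ + 1)) : i.castSucc = 0 ↔ i = 0 := Fin.castSucc_eq_zero_iff
  have hlz : Fin.last (ℓ + 1) ≠ 0 := Fin.last_pos.ne'
  simp only [shiftedForm, Fintype.sum_sum_type, pathExt_adj_inl_inl, pathExt_adj_inl_inr,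
    pathExt_adj_inr_inl, pathExt_adj_inr_inr, Fin.sum_univ_castSucc (n := ℓ + 1), Fin.val_castSucc,
    Fin.val_last, hlast, hlast', hz, hzero, hlz, and_false, if_false, Function.comp_apply, Sum.map_inl,
    Sum.map_inr, id, Finset.sum_add_distrib, Finset.sum_ite_eq', Finset.mem_univ, if_true,
    Finset.sum_const_zero]
  ring

theorem exists_shiftedForm_lt_sq_of_succ {V : Type*} [Fintype V] (F : SimpleGraph V)
    (A : Set V) {c : ℝ} (hc : 2 ≤ c) (ℓ : ℕ)
    (h : ∃ x, shiftedForm (pathExt F A (ℓ + 1)) c x < x (Sum.inr (Fin.last (ℓ + 1))) ^ 2) :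
    ∃ x, shiftedForm (pathExt F A ℓ) c x < x (Sum.inr (Fin.last ℓ)) ^ 2 := by
  obtain ⟨x, hx⟩ := h
  refine ⟨x ∘ Sum.map id Fin.castSucc, ?_⟩
  rw [shiftedForm_pathExt_succ] at hx
  simp only [Function.comp_apply, Sum.map_inr]
  nlinarith [sq_nonneg (x (Sum.inr (Fin.last ℓ).castSucc) + x (Sum.inr (Fin.last (ℓ + 1)))),
    mul_nonneg (sub_nonneg.2 hc) (sq_nonneg (x (Sum.inr (Fin.last (ℓ + 1)))))]

theorem eventually_minEig_pathCliqueExt_lt {V : Type*} [Fintype V] (F : SimpleGraph V)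
    (A : Set V) {c : ℝ} (hc : 0 ≤ c) (ℓ : ℕ)
    (h : ∃ x, shiftedForm (pathExt F A ℓ) c x < x (Sum.inr (Fin.last ℓ)) ^ 2) :
    ∀ᶠ m : ℕ in Filter.atTop, minEig (adjMat (pathCliqueExt F A ℓ m)) < -c := by
  obtain ⟨x, hx⟩ := h
  set q := shiftedForm (pathExt F A ℓ) c x with hq
  set s := x (Sum.inr (Fin.last ℓ)) with hs
  have hlim : Filter.Tendsto (fun m : ℕ => q - s ^ 2 + ((c - 1) * s ^ 2) / (m : ℝ))
      Filter.atTop (nhds (q - s ^ 2 + 0)) :=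
    (tendsto_const_div_atTop_nhds_zero_nat _).const_add _
  have hneg : q - s ^ 2 + 0 < 0 := by linarith
  filter_upwards [hlim.eventually_lt_const hneg, Filter.eventually_gt_atTop 0] with m hm hm0
  have hm0' : (m : ℝ) ≠ 0 := by positivity
  refine (minEig_adjMat_lt_iff _ hc).2 ⟨Sum.elim x fun _ => -s / m, ?_⟩
  rw [shiftedForm_pathCliqueExt, ← hq, ← hs]
  refine lt_of_eq_of_lt ?_ hm
  field_simp
  ring

/-- If the path extensions of `(F, A)` eventually have smallest eigenvalue below `-λ`
(for `λ ≥ 2`), then for some `m ≥ 1` all path-clique extensions `(F, A, ℓ, K_m)` have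
smallest eigenvalue below `-λ`. -/
theorem path_clique_extension_eigenvalue {V : Type*} [Fintype V]
    (F : SimpleGraph V) (A : Set V) (hA : A.Nonempty) (lam : ℝ) (hlam : 2 ≤ lam)
    (h : ∃ ℓ₀ : ℕ, ∀ ℓ : ℕ, ℓ₀ ≤ ℓ → minEig (adjMat (pathExt F A ℓ)) < -lam) :
    ∃ m : ℕ, 0 < m ∧ ∀ ℓ : ℕ, minEig (adjMat (pathCliqueExt F A ℓ m)) < -lam := by
  obtain ⟨ℓ₀, h⟩ := h
  have hc : 0 ≤ lam := by linarith
  have hlarge (ℓ : ℕ) (hℓ : ℓ₀ ≤ ℓ) : ∃ x, shiftedForm (pathExt F A ℓ) lam x < 0 :=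
    (minEig_adjMat_lt_iff _ hc).1 (h ℓ hℓ)
  have hsmall (ℓ : ℕ) (hℓ : ℓ ≤ ℓ₀) :
      ∃ x, shiftedForm (pathExt F A ℓ) lam x < x (Sum.inr (Fin.last ℓ)) ^ 2 := by
    induction hℓ using Nat.decreasingInduction with
    | self =>
      obtain ⟨x, hx⟩ := hlarge ℓ₀ le_rfl
      exact ⟨x, hx.trans_le (sq_nonneg _)⟩
    | of_succ k _ ih => exact exists_shiftedForm_lt_sq_of_succ F A hlam k ih
  have hev : ∀ᶠ m : ℕ in Filter.atTop, ∀ ℓ ∈ Finset.range ℓ₀,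
      minEig (adjMat (pathCliqueExt F A ℓ m)) < -lam :=
    (Filter.eventually_all_finset _).2 fun ℓ hℓ =>
      eventually_minEig_pathCliqueExt_lt F A hc ℓ (hsmall ℓ (Finset.mem_range.1 hℓ).le)
  obtain ⟨m, hm, hm0⟩ := (hev.and (Filter.eventually_gt_atTop 0)).exists
  refine ⟨m, hm0, fun ℓ => ?_⟩
  rcases lt_or_ge ℓ ℓ₀ with hℓ | hℓ
  · exact hm ℓ (Finset.mem_range.2 hℓ)
  · obtain ⟨x, hx⟩ := hlarge ℓ hℓ
    refine (minEig_adjMat_lt_iff _ hc).2 ⟨Sum.elim x fun _ => 0, ?_⟩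
    rw [shiftedForm_pathCliqueExt]
    simpa using hx
end

section
/- For every real λ > λ* and every ε > 0 there exists a graph G with |λ₁(G) − (−λ)| < ε; in other words, for every λ > λ* there is a sequence of graphs whose smallest eigenvalues converge to −λ. -/
open Classical

section QuadraticForm

variable {V W : Type*} [Fintype V] [Fintype W]

/-- The quadratic form of `A + l • 1`, where `A` is the adjacency matrix of `G`. -/
noncomputable def quadForm (l : ℝ) (G : SimpleGraph V) (x : V → ℝ) : ℝ :=
  ∑ i, ∑ j, adjMat G i j * x i * x j + l * ∑ i, x i ^ 2

/-- The sum of the coordinates of `x` over the vertices in `C`. -/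
noncomputable def portSum (C : Set V) (x : V → ℝ) : ℝ :=
  ∑ i, if i ∈ C then x i else 0

/-- The disjoint union of `G` and `H`, together with all edges between `C` and `D`. -/
def joinOn (G : SimpleGraph V) (H : SimpleGraph W) (C : Set V) (D : Set W) :
    SimpleGraph (V ⊕ W) where
  Adj
    | Sum.inl a, Sum.inl b => G.Adj a b
    | Sum.inr a, Sum.inr b => H.Adj a b
    | Sum.inl a, Sum.inr b => a ∈ C ∧ b ∈ D
    | Sum.inr b, Sum.inl a => a ∈ C ∧ b ∈ D
  symm := ⟨by
    rintro (a | a) (b | b) h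
    · exact G.adj_symm h
    · exact h
    · exact h
    · exact H.adj_symm h⟩
  loopless := ⟨by
    rintro (a | a) h
    · exact G.irrefl h
    · exact H.irrefl h⟩

theorem quadForm_smul (l c : ℝ) (G : SimpleGraph V) (x : V → ℝ) :
    quadForm l G (c • x) = c ^ 2 * quadForm l G x := by
  simp only [quadForm, Pi.smul_apply, smul_eq_mul, mul_add, Finset.mul_sum]
  congr 1
  · exact Finset.sum_congr rfl fun i _ => Finset.sum_congr rfl fun j _ => by ring
  · exact Finset.sum_congr rfl fun i _ => by ring

theorem portSum_smul (c : ℝ) (C : Set V) (x : V → ℝ) :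
    portSum C (c • x) = c * portSum C x := by
  simp [portSum, Finset.mul_sum]

theorem portSum_singleton (r : V) (x : V → ℝ) : portSum {r} x = x r := by
  simp [portSum]

theorem portSum_sumElim (C : Set V) (D : Set W) (x : V ⊕ W → ℝ) :
    portSum (Sum.inl '' C ∪ Sum.inr '' D) x =
      portSum C (fun v => x (Sum.inl v)) + portSum D (fun w => x (Sum.inr w)) := by
  simp [portSum, Fintype.sum_sum_type]

theorem quadForm_joinOn (l : ℝ) (G : SimpleGraph V) (H : SimpleGraph W) (C : Set V) (D : Set W)
    (x : V ⊕ W → ℝ) :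
    quadForm l (joinOn G H C D) x =
      quadForm l G (fun v => x (Sum.inl v)) + quadForm l H (fun w => x (Sum.inr w)) +
        2 * portSum C (fun v => x (Sum.inl v)) * portSum D (fun w => x (Sum.inr w)) := by
  have hcross : portSum C (fun v => x (Sum.inl v)) * portSum D (fun w => x (Sum.inr w)) =
      ∑ i : V, ∑ j : W,
        adjMat (joinOn G H C D) (Sum.inl i) (Sum.inr j) * x (Sum.inl i) * x (Sum.inr j) := by
    rw [portSum, portSum, Finset.sum_mul_sum]
    refine Finset.sum_congr rfl fun i _ => Finset.sum_congr rfl fun j _ => ?_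
    by_cases h1 : i ∈ C <;> by_cases h2 : j ∈ D <;> simp [adjMat, joinOn, h1, h2]
  have hcross' : portSum C (fun v => x (Sum.inl v)) * portSum D (fun w => x (Sum.inr w)) =
      ∑ j : W, ∑ i : V,
        adjMat (joinOn G H C D) (Sum.inr j) (Sum.inl i) * x (Sum.inr j) * x (Sum.inl i) := by
    rw [hcross, Finset.sum_comm]
    refine Finset.sum_congr rfl fun j _ => Finset.sum_congr rfl fun i _ => ?_
    rw [adjMat, adjMat, (joinOn G H C D).adj_comm]
    ring
  have hl : ∀ i j, adjMat (joinOn G H C D) (Sum.inl i) (Sum.inl j) = adjMat G i j :=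
    fun _ _ => rfl
  have hr : ∀ i j, adjMat (joinOn G H C D) (Sum.inr i) (Sum.inr j) = adjMat H i j :=
    fun _ _ => rfl
  rw [mul_assoc, two_mul]
  nth_rewrite 1 [hcross]
  rw [hcross']
  simp only [quadForm, Fintype.sum_sum_type, Finset.sum_add_distrib, hl, hr]
  ring

theorem quadForm_comap (l : ℝ) (e : V ≃ W) (G : SimpleGraph W) (x : W → ℝ) :
    quadForm l (G.comap e) (x ∘ e) = quadForm l G x := by
  simp only [quadForm, adjMat, SimpleGraph.comap_adj, Function.comp_apply]
  congr 1
  · rw [← Equiv.sum_comp e]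
    exact Finset.sum_congr rfl fun i _ =>
      Equiv.sum_comp e (fun j => (if G.Adj (e i) j then (1 : ℝ) else 0) * x (e i) * x j)
  · rw [Equiv.sum_comp e (fun i => x i ^ 2)]

theorem quadForm_eq_dotProduct (l : ℝ) (G : SimpleGraph V) (x : V → ℝ) :
    quadForm l G x = x ⬝ᵥ (adjMat G).mulVec x + l * (x ⬝ᵥ x) := by
  simp only [quadForm, dotProduct, Matrix.mulVec, Finset.mul_sum]
  congr 1
  · exact Finset.sum_congr rfl fun i _ => Finset.sum_congr rfl fun j _ => by ring
  · exact Finset.sum_congr rfl fun i _ => by ring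

end QuadraticForm

/-- `f` is the Schur complement of `A + l • 1` at the root of some finite rooted graph. -/
def RootValue (l f : ℝ) : Prop :=
  ∃ (V : Type) (_ : Fintype V) (G : SimpleGraph V) (r : V),
    (∀ x, f * x r ^ 2 ≤ quadForm l G x) ∧ ∃ x, x r = 1 ∧ quadForm l G x = f

/-- `k` is the amount subtracted from the diagonal of `A + l • 1` at a vertex when the vertex is
joined to the distinguished vertices of some finite graph, which are then eliminated. -/
def PortValue (l k : ℝ) : Prop :=
  ∃ (V : Type) (_ : Fintype V) (G : SimpleGraph V) (C : Set V),
    (∀ x y, -(k * y ^ 2) ≤ quadForm l G x + 2 * y * portSum C x) ∧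
      ∃ x, quadForm l G x + 2 * portSum C x = -k

theorem rootValue_self (l : ℝ) : RootValue l l :=
  ⟨Unit, inferInstance, ⊥, (), by simp [quadForm, adjMat], fun _ => 1, rfl, by
    simp [quadForm, adjMat]⟩

theorem portValue_zero (l : ℝ) : PortValue l 0 :=
  ⟨Empty, inferInstance, ⊥, ∅, by simp [quadForm, portSum], fun _ => 0, by
    simp [quadForm, portSum]⟩

theorem RootValue.portValue {l f : ℝ} (h : RootValue l f) (hf : 0 < f) : PortValue l (1 / f) := by
  obtain ⟨V, _, G, r, hle, x₀, hr, hx₀⟩ := h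
  refine ⟨V, inferInstance, G, {r}, fun x y => ?_, (-(1 / f)) • x₀, ?_⟩
  · rw [portSum_singleton]
    have h2 : f * x r ^ 2 + 2 * y * x r + 1 / f * y ^ 2 = (f * x r + y) ^ 2 / f := by
      field_simp
      ring
    have h3 : 0 ≤ (f * x r + y) ^ 2 / f := by positivity
    linarith [hle x]
  · rw [portSum_singleton, quadForm_smul, hx₀, Pi.smul_apply, hr, smul_eq_mul]
    field_simp
    ring

theorem RootValue.sub {l f k : ℝ} (h : RootValue l f) (hk : PortValue l k) :
    RootValue l (f - k) := by
  obtain ⟨V, _, G, r, hle, x₀, hr, hx₀⟩ := h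
  obtain ⟨W, _, H, C, hle', z₀, hz₀⟩ := hk
  refine ⟨V ⊕ W, inferInstance, joinOn G H {r} C, Sum.inl r, fun x => ?_, Sum.elim x₀ z₀, hr, ?_⟩
  · rw [quadForm_joinOn, portSum_singleton]
    linarith [hle (fun v => x (Sum.inl v)), hle' (fun w => x (Sum.inr w)) (x (Sum.inl r))]
  · rw [quadForm_joinOn, portSum_singleton]
    simp only [Sum.elim_inl, Sum.elim_inr]
    rw [hr, hx₀]
    linarith

/-- A root is added to the distinguished vertices, and joined to all of them. -/
theorem PortValue.insert {l g T : ℝ} (h : PortValue l (1 - 1 / T)) (hg : RootValue l g)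
    (hT : 0 < T) (hg1 : 1 < g) : PortValue l (1 - 1 / (T + 1 / (g - 1))) := by
  obtain ⟨V, _, G, C, hle, x₀, hx₀⟩ := h
  obtain ⟨W, _, H, r, hle', z₀, hr, hz₀⟩ := hg
  obtain ⟨d, rfl⟩ : ∃ d, g = d + 1 := ⟨g - 1, by ring⟩
  have hd : 0 < d := by linarith
  simp only [add_sub_cancel_right]
  have hTd : 0 < T * d + 1 := by positivity
  refine ⟨V ⊕ W, inferInstance, joinOn G H C {r}, Sum.inl '' C ∪ Sum.inr '' {r}, fun x y => ?_,
    Sum.elim ((T * d / (T * d + 1)) • x₀) ((-(1 / (T * d + 1))) • z₀), ?_⟩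
  · rw [quadForm_joinOn, portSum_sumElim, portSum_singleton]
    have h1 := hle (fun v => x (Sum.inl v)) (y + x (Sum.inr r))
    have h2 := hle' (fun w => x (Sum.inr w))
    have h3 : (y + x (Sum.inr r)) ^ 2 / T + d * x (Sum.inr r) ^ 2 - y ^ 2 / (T + 1 / d) =
        (y + x (Sum.inr r) * (T * d + 1)) ^ 2 / (T * (T * d + 1)) := by
      field_simp
      ring
    have h4 : 0 ≤ (y + x (Sum.inr r) * (T * d + 1)) ^ 2 / (T * (T * d + 1)) := by positivity
    have h5 : (1 - 1 / T) * (y + x (Sum.inr r)) ^ 2 =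
        (y + x (Sum.inr r)) ^ 2 - (y + x (Sum.inr r)) ^ 2 / T := by ring
    have h6 : (1 - 1 / (T + 1 / d)) * y ^ 2 = y ^ 2 - y ^ 2 / (T + 1 / d) := by ring
    rw [h6]
    rw [h5] at h1
    linarith
  · rw [quadForm_joinOn, portSum_sumElim, portSum_singleton]
    have e1 : (fun v => Sum.elim ((T * d / (T * d + 1)) • x₀) ((-(1 / (T * d + 1))) • z₀)
        (Sum.inl v)) = (T * d / (T * d + 1)) • x₀ := rfl
    have e2 : (fun w => Sum.elim ((T * d / (T * d + 1)) • x₀) ((-(1 / (T * d + 1))) • z₀)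
        (Sum.inr w)) = (-(1 / (T * d + 1))) • z₀ := rfl
    have e3 : Sum.elim ((T * d / (T * d + 1)) • x₀) ((-(1 / (T * d + 1))) • z₀)
        (Sum.inr r) = -(1 / (T * d + 1)) := by simp [hr]
    rw [e1, e2, e3, quadForm_smul, quadForm_smul, portSum_smul, hz₀,
      show quadForm l G x₀ = -(1 - 1 / T) - 2 * portSum C x₀ by linarith]
    field_simp
    ring

theorem PortValue.insert_iterate {l g T : ℝ} (h : PortValue l (1 - 1 / T)) (hg : RootValue l g)
    (hT : 0 < T) (hg1 : 1 < g) (n : ℕ) : PortValue l (1 - 1 / (T + n * (1 / (g - 1)))) := by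
  have hc : 0 < 1 / (g - 1) := one_div_pos.mpr (by linarith)
  induction n with
  | zero => simpa using h
  | succ n ih =>
    have := ih.insert hg (by positivity) hg1
    rwa [show T + ((n + 1 : ℕ) : ℝ) * (1 / (g - 1)) = T + n * (1 / (g - 1)) + 1 / (g - 1) by
      push_cast; ring]

/-- A root is joined to all the distinguished vertices, and becomes the only distinguished one. -/
theorem PortValue.cone {l g T : ℝ} (h : PortValue l (1 - 1 / T)) (hg : RootValue l g)
    (hT : 0 < T) (hg2 : 2 < g) : PortValue l (1 - 1 / (1 + T / (1 + (g - 2) * T))) := by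
  obtain ⟨d, rfl⟩ : ∃ d, g = d + 2 := ⟨g - 2, by ring⟩
  have hd : 0 < d := by linarith
  have hT' : 0 < 1 / T := by positivity
  have h1 := (hg.sub h).portValue (by linarith)
  convert h1 using 1
  simp only [add_sub_cancel_right]
  have : d + 2 - (1 - 1 / T) = ((d + 1) * T + 1) / T := by
    field_simp
    ring
  rw [this]
  field_simp
  ring

/-- Backward iteration of the contraction `T ↦ 1 + T / (1 + δ * T)` and of the shift by
`1 / (1 + δ)` approximates every number in an invariant half-line from below. -/
theorem exists_mem_approx {R : Set ℝ} {δ b : ℝ} (hδ : 0 < δ) (hb1 : 1 ≤ b)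
    (hb : 1 ≤ δ * b * (b - 1)) (hδb : δ ^ 2 * b ≤ 1) (hone : (1 : ℝ) ∈ R)
    (hshift : ∀ T ∈ R, 1 ≤ T → ∀ n : ℕ, T + n * (1 / (1 + δ)) ∈ R)
    (hcone : ∀ T ∈ R, 1 ≤ T → 1 + T / (1 + δ * T) ∈ R) (n : ℕ) :
    ∀ x, b ≤ x → ∃ T ∈ R, 1 ≤ T ∧ T ≤ x ∧ x - (1 / (1 + δ)) ^ n ≤ T := by
  have hc : 0 < 1 / (1 + δ) := by positivity
  have hround : ∀ u x : ℝ, u ≤ x → ∃ k : ℕ,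
      u + k * (1 / (1 + δ)) ≤ x ∧ x < u + k * (1 / (1 + δ)) + 1 / (1 + δ) := by
    intro u x hux
    refine ⟨⌊(x - u) / (1 / (1 + δ))⌋₊, ?_, ?_⟩
    · have := Nat.floor_le (div_nonneg (sub_nonneg.mpr hux) hc.le)
      rw [le_div_iff₀ hc] at this
      linarith
    · have := Nat.lt_floor_add_one ((x - u) / (1 / (1 + δ)))
      rw [div_lt_iff₀ hc] at this
      linarith
  induction n with
  | zero =>
    intro x hx
    obtain ⟨k, hk1, hk2⟩ := hround 1 x (hb1.trans hx)
    refine ⟨1 + k * (1 / (1 + δ)), hshift 1 hone le_rfl k, ?_, hk1, ?_⟩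
    · have : 0 ≤ (k : ℝ) * (1 / (1 + δ)) := by positivity
      linarith
    · have : 1 / (1 + δ) ≤ 1 := by
        rw [div_le_one (by positivity)]
        linarith
      rw [pow_zero]
      linarith
  | succ n ih =>
    intro x hx
    have hden : 0 < 1 + δ * b := by positivity
    have hφb : 1 + b / (1 + δ * b) ≤ b := by
      have : b / (1 + δ * b) ≤ b - 1 := by
        rw [div_le_iff₀ hden]
        nlinarith
      linarith
    obtain ⟨k, hk1, hk2⟩ := hround (1 + b / (1 + δ * b)) x (hφb.trans hx)
    set u := x - k * (1 / (1 + δ)) - 1 with hu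
    have hu1 : b / (1 + δ * b) ≤ u := by linarith
    have hu2 : δ * u < 1 := by
      have h1 : u < b / (1 + δ * b) + 1 / (1 + δ) := by linarith
      have h2 : δ * (b / (1 + δ * b) + 1 / (1 + δ)) ≤ 1 := by
        rw [show δ * (b / (1 + δ * b) + 1 / (1 + δ)) =
          (δ * b * (1 + δ) + δ * (1 + δ * b)) / ((1 + δ * b) * (1 + δ)) by field_simp,
          div_le_one (by positivity)]
        nlinarith
      nlinarith
    have hden' : 0 < 1 - δ * u := by linarith
    have hby : b ≤ u / (1 - δ * u) := by
      rw [le_div_iff₀ hden']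
      rw [div_le_iff₀ hden] at hu1
      linarith
    obtain ⟨T, hTR, hT1, hTy, hyT⟩ := ih _ hby
    set y := u / (1 - δ * u) with hy
    have hy1 : 1 ≤ y := hb1.trans hby
    have huy : u = y / (1 + δ * y) := by
      have h1 : 1 + δ * y = 1 / (1 - δ * u) := by
        rw [hy]
        field_simp
        ring
      rw [eq_div_iff (by positivity), h1, mul_one_div]
    have hdy : 0 < 1 + δ * y := by positivity
    have hdT : 0 < 1 + δ * T := by positivity
    have hdiff : u - T / (1 + δ * T) = (y - T) / ((1 + δ * y) * (1 + δ * T)) := by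
      rw [huy]
      field_simp
      ring
    refine ⟨1 + T / (1 + δ * T) + k * (1 / (1 + δ)), hshift _ (hcone T hTR hT1) ?_ k, ?_, ?_, ?_⟩
    · have : 0 ≤ T / (1 + δ * T) := by positivity
      linarith
    · have : 0 ≤ T / (1 + δ * T) + k * (1 / (1 + δ)) := by positivity
      linarith
    · have : 0 ≤ (y - T) / ((1 + δ * y) * (1 + δ * T)) :=
        div_nonneg (by linarith) (by positivity)
      linarith
    · have h1 : (y - T) / ((1 + δ * y) * (1 + δ * T)) ≤ (1 / (1 + δ)) ^ n / (1 + δ) := by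
        refine div_le_div₀ (by positivity) (by linarith) (by positivity) ?_
        nlinarith [mul_nonneg hδ.le (sub_nonneg.mpr hy1), mul_pos hδ (by linarith : 0 < T)]
      have h2 : (1 / (1 + δ)) ^ (n + 1) = (1 / (1 + δ)) ^ n / (1 + δ) := by
        rw [pow_succ, mul_one_div]
      rw [h2]
      linarith

/-- A root value `f < 1` above the repelling fixed point of `f ↦ g - 1 / f` can be lowered to an
arbitrarily small nonnegative root value. -/
theorem exists_rootValue_small {l g f : ℝ} (hg : RootValue l g) (hf : RootValue l f)
    (hg2 : 2 < g) (hg3 : g ≤ 5 / 2) (hf0 : 0 < f) (hf1 : f < 1) (hfg : f ^ 2 + 1 ≤ g * f)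
    {ε : ℝ} (hε : 0 < ε) : ∃ s, RootValue l s ∧ 0 ≤ s ∧ s ≤ ε := by
  obtain ⟨δ, rfl⟩ : ∃ δ, g = 2 + δ := ⟨g - 2, by ring⟩
  have hδ : 0 < δ := by linarith
  have hδ2 : δ ≤ 1 / 2 := by linarith
  have h1f : 0 < 1 - f := by linarith
  have hx1 : 1 ≤ 1 / (1 - f) := by
    rw [le_div_iff₀ h1f]
    linarith
  have hx : 1 ≤ δ * (1 / (1 - f)) * (1 / (1 - f) - 1) := by
    rw [show δ * (1 / (1 - f)) * (1 / (1 - f) - 1) = δ * f / (1 - f) ^ 2 by field_simp; ring,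
      le_div_iff₀ (by positivity)]
    linarith
  have hd1 : 1 ≤ 1 / δ ^ 2 := by
    rw [le_div_iff₀ (by positivity)]
    nlinarith
  have hd : 1 ≤ δ * (1 / δ ^ 2) * (1 / δ ^ 2 - 1) := by
    rw [show δ * (1 / δ ^ 2) * (1 / δ ^ 2 - 1) = (1 - δ ^ 2) / δ ^ 3 by field_simp,
      le_div_iff₀ (by positivity)]
    nlinarith [mul_pos hδ hδ]
  obtain ⟨b, hbx, hb1, hb, hδb⟩ : ∃ b, b ≤ 1 / (1 - f) ∧ 1 ≤ b ∧ 1 ≤ δ * b * (b - 1) ∧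
      δ ^ 2 * b ≤ 1 := by
    rcases le_total (1 / (1 - f)) (1 / δ ^ 2) with h | h
    · refine ⟨_, le_rfl, hx1, hx, ?_⟩
      rwa [le_div_iff₀' (by positivity)] at h
    · refine ⟨_, h, hd1, hd, ?_⟩
      rw [mul_one_div_cancel (by positivity)]
  obtain ⟨n, hn⟩ := exists_pow_lt_of_lt_one hε
    (show 1 / (1 + δ) < 1 by rw [div_lt_one (by positivity)]; linarith)
  obtain ⟨T, hTR, hT1, hTx, hxT⟩ := exists_mem_approx (R := {T | PortValue l (1 - 1 / T)}) hδ hb1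
    hb hδb (by simpa using portValue_zero l)
    (fun T hT hT1 n => by
      have := PortValue.insert_iterate hT hg (by linarith) (by linarith) n
      rwa [show 2 + δ - 1 = 1 + δ by ring] at this)
    (fun T hT hT1 => by
      have := PortValue.cone hT hg (by linarith) (by linarith)
      rwa [show 2 + δ - 2 = δ by ring] at this) n _ hbx
  refine ⟨_, hf.sub hTR, ?_, ?_⟩
  · have : 1 - f ≤ 1 / T := by
      rw [le_div_iff₀' (by linarith)]
      rwa [le_div_iff₀ h1f] at hTx
    linarith
  · have h1 : 1 / T ≤ 1 - f + ε := by
      rw [div_le_iff₀ (by linarith)]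
      have h2 : (1 / (1 - f) - T) * (1 - f) = 1 - T * (1 - f) := by field_simp
      have h3 : (1 / (1 - f) - T) * (1 - f) ≤ ε * T := by nlinarith
      nlinarith
    linarith

theorem RootValue.sub_nat_mul {l f k : ℝ} (h : RootValue l f) (hk : PortValue l k) (n : ℕ) :
    RootValue l (f - n * k) := by
  induction n with
  | zero => simpa using h
  | succ n ih =>
    convert ih.sub hk using 1
    push_cast
    ring

/-- The root value of a root with one pendant vertex and an adjacent clique of `n` vertices. -/
theorem RootValue.pendant_clique {l g : ℝ} (hg : RootValue l g) (hg1 : 1 < g) (n : ℕ) :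
    RootValue l (g - 1 / g - n / (g - 1 + n)) := by
  have h0 : PortValue l (1 - 1 / (1 : ℝ)) := by simpa using portValue_zero l
  have h := (hg.sub (hg.portValue (by linarith))).sub
    (h0.insert_iterate hg one_pos hg1 n)
  convert h using 2
  have : 0 < g - 1 := by linarith
  field_simp
  ring

/-- The spectral radius of the infinite tree `T(1, 2, ∞)` is the threshold beyond which the root
value of `T(1, 2)` exceeds the repelling fixed point. -/
theorem exists_rootValue_lt_one {l g β : ℝ} (hβ : β ^ 3 = β + 1) (hg : RootValue l g)
    (hlo : √β + (√β)⁻¹ < g) (hhi : g ≤ 5 / 2) :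
    2 < g ∧ ∃ f, RootValue l f ∧ 0 < f ∧ f < 1 ∧ f ^ 2 + 1 ≤ g * f := by
  have hβ1 : 1 < β := by
    by_contra! h
    nlinarith [sq_nonneg (β + 1), sq_nonneg β, sq_nonneg (β - 1)]
  obtain ⟨s, hs1, rfl⟩ : ∃ s : ℝ, 1 < s ∧ β = s ^ 2 :=
    ⟨√β, Real.lt_sqrt_of_sq_lt (by simpa using hβ1), (Real.sq_sqrt (by linarith)).symm⟩
  rw [Real.sqrt_sq (by linarith)] at hlo
  have hs0 : 0 < s := by linarith
  have hg2 : 2 < g := by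
    have : 2 ≤ s + s⁻¹ := by
      have : s + s⁻¹ - 2 = (s - 1) ^ 2 / s := by field_simp; ring
      have : 0 ≤ (s - 1) ^ 2 / s := by positivity
      linarith
    linarith
  refine ⟨hg2, ?_⟩
  have hg0 : 0 < g := by linarith
  rcases le_total g (209 / 100) with h1 | h1
  · have hport := hg.portValue hg0
    have hgi : 1 / g < 1 / 2 := one_div_lt_one_div_of_lt two_pos hg2
    have hF := (hg.sub hport).sub ((hg.sub hport).portValue (by linarith))
    have hmono : s⁻¹ ≤ g - 1 / g - 1 / (g - 1 / g) := by
      set m := s + s⁻¹ with hm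
      have hm0 : 0 < m := by positivity
      have hs6 : s ^ 6 = s ^ 2 + 1 := by linear_combination hβ
      have hm1 : m - 1 / m = s ^ 3 := by
        have : m = s ^ 5 := by
          rw [hm]
          field_simp
          linear_combination -hs6
        rw [this]
        field_simp
        linear_combination (s ^ 4 - s ^ 2 + 1) * hs6
      have hlt : s ^ 3 ≤ g - 1 / g := by
        rw [← hm1]
        have := one_div_le_one_div_of_le hm0 hlo.le
        linarith
      have h3 : (0 : ℝ) < s ^ 3 := by positivity
      have := one_div_le_one_div_of_le h3 hlt
      have h7 : s ^ 3 - 1 / s ^ 3 = s⁻¹ := by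
        field_simp
        linear_combination hs6
      linarith
    have hlt1 : g - 1 / g - 1 / (g - 1 / g) < 1 := by
      have h3 : 1 / (209 / 100) ≤ 1 / g := one_div_le_one_div_of_le hg0 h1
      have h4 : 1 / (209 / 100 - 1 / (209 / 100) : ℝ) ≤ 1 / (g - 1 / g) :=
        one_div_le_one_div_of_le (by linarith) (by linarith)
      norm_num at h3 h4 ⊢
      linarith
    refine ⟨_, hF, lt_of_lt_of_le (by positivity) hmono, hlt1, ?_⟩
    set f := g - 1 / g - 1 / (g - 1 / g)
    have h8 : (f - s⁻¹) * (f - s) ≤ 0 :=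
      mul_nonpos_of_nonneg_of_nonpos (by linarith) (by linarith)
    have h9 : s⁻¹ * s = 1 := inv_mul_cancel₀ hs0.ne'
    have hf0 : 0 < f := lt_of_lt_of_le (by positivity) hmono
    nlinarith
  · suffices h : ∃ f a b, RootValue l f ∧ 0 < a ∧ b < 1 ∧ a ≤ f ∧ f ≤ b ∧
        a ^ 2 + 1 ≤ g * a ∧ b ^ 2 + 1 ≤ g * b by
      obtain ⟨f, a, b, hf, ha, hb, haf, hfb, hga, hgb⟩ := h
      refine ⟨f, hf, by linarith, by linarith, ?_⟩
      by_contra! hlt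
      have hab : a < b := by
        by_contra! hba
        obtain rfl : f = a := by linarith
        linarith
      nlinarith [mul_nonneg (sub_nonneg.mpr haf) (sub_nonneg.mpr hfb),
        mul_nonneg (sub_nonneg.mpr haf) (sub_nonneg.mpr hgb),
        mul_nonneg (sub_nonneg.mpr hfb) (sub_nonneg.mpr hga)]
    rcases le_total g (216 / 100) with h2 | h2
    · have hF := hg.pendant_clique (by linarith) 3
      refine ⟨_, 877 / 1000, 977 / 1000, hF, by norm_num, by norm_num, ?_, ?_, by linarith,
        by linarith⟩
      · have e1 := one_div_le_one_div_of_le (by norm_num) h1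
        have e2 : 3 / (g - 1 + 3) ≤ 3 / (209 / 100 - 1 + 3) := by gcongr
        norm_num at e1 e2 ⊢
        linarith
      · have e1 := one_div_le_one_div_of_le hg0 h2
        have e2 : 3 / (216 / 100 - 1 + 3) ≤ 3 / (g - 1 + 3) := by gcongr; linarith
        norm_num at e1 e2 ⊢
        linarith
    rcases le_total g (233 / 100) with h3 | h3
    · have hF := hg.pendant_clique (by linarith) 20
      refine ⟨_, 751 / 1000, 964 / 1000, hF, by norm_num, by norm_num, ?_, ?_, by linarith,
        by linarith⟩
      · have e1 := one_div_le_one_div_of_le (by norm_num) h2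
        have e2 : 20 / (g - 1 + 20) ≤ 20 / (216 / 100 - 1 + 20) := by gcongr
        norm_num at e1 e2 ⊢
        linarith
      · have e1 := one_div_le_one_div_of_le hg0 h3
        have e2 : 20 / (233 / 100 - 1 + 20) ≤ 20 / (g - 1 + 20) := by gcongr; linarith
        norm_num at e1 e2 ⊢
        linarith
    · have hF := hg.sub_nat_mul (hg.portValue hg0) 4
      refine ⟨_, 61 / 100, 9 / 10, hF, by norm_num, by norm_num, ?_, ?_, by linarith,
        by linarith⟩
      · have e1 := one_div_le_one_div_of_le (by norm_num) h3
        norm_num at e1 ⊢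
        linarith
      · have e1 := one_div_le_one_div_of_le hg0 hhi
        norm_num at e1 ⊢
        linarith

/-- The smallest eigenvalue is controlled by a lower bound on, and a test vector for, the
quadratic form. -/
theorem minEig_mem_Icc {V : Type*} [Fintype V] {G : SimpleGraph V} {l ε : ℝ}
    (hpos : ∀ x, 0 ≤ quadForm l G x) {x : V → ℝ} (hx : x ≠ 0)
    (hle : quadForm l G x ≤ ε * (x ⬝ᵥ x)) :
    minEig (adjMat G) ∈ Set.Icc (-l) (-l + ε) := by
  have hlower : ∀ μ ∈ {μ : ℝ | IsEigenvalue (adjMat G) μ}, -l ≤ μ := by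
    rintro μ ⟨v, hv, hvμ⟩
    have h1 := hpos v
    rw [quadForm_eq_dotProduct, hvμ, dotProduct_smul, smul_eq_mul] at h1
    have h2 : 0 < v ⬝ᵥ v := by
      simpa using Matrix.dotProduct_star_self_pos_iff.mpr hv
    nlinarith
  obtain ⟨μ, hμ, hμle⟩ : ∃ μ, IsEigenvalue (adjMat G) μ ∧ μ ≤ -l + ε := by
    have hB : (adjMat G + (l - ε) • (1 : Matrix V V ℝ)).IsHermitian := by
      ext i j
      simp [adjMat, G.adj_comm, Matrix.one_apply, eq_comm]
    by_contra! hall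
    have hpd := hB.posDef_iff_eigenvalues_pos.mpr fun i => by
      have hv := hB.mulVec_eigenvectorBasis i
      rw [Matrix.add_mulVec, Matrix.smul_mulVec, Matrix.one_mulVec] at hv
      have := hall (hB.eigenvalues i - (l - ε)) ⟨hB.eigenvectorBasis i, fun h0 => ?_, ?_⟩
      · linarith
      · exact hB.eigenvectorBasis.toBasis.ne_zero i (by ext j; simpa using congrFun h0 j)
      · exact (eq_sub_of_add_eq hv).trans (sub_smul _ _ _).symm
    have := hpd.dotProduct_mulVec_pos hx
    rw [Matrix.add_mulVec, Matrix.smul_mulVec, Matrix.one_mulVec, star_trivial, dotProduct_add,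
      dotProduct_smul, smul_eq_mul] at this
    rw [quadForm_eq_dotProduct] at hle
    linarith
  exact ⟨le_csInf ⟨μ, hμ⟩ hlower, (csInf_le ⟨-l, hlower⟩ hμ).trans hμle⟩

/-- Pendant vertices at each vertex lower the diagonal `l` to some `g` in a bounded range. -/
theorem exists_rootValue_le {l m : ℝ} (hl : m < l) (hm : m ≤ 21 / 10) :
    ∃ g, RootValue l g ∧ m < g ∧ g ≤ 5 / 2 := by
  rcases le_total l (5 / 2) with h | h
  · exact ⟨l, rootValue_self l, hl, h⟩
  have hl0 : 0 < l := by linarith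
  have hi : 1 / l ≤ 2 / 5 := by
    rw [div_le_iff₀ hl0]
    linarith
  have hi0 : 0 < 1 / l := by positivity
  refine ⟨l - ⌈(l - 5 / 2) / (1 / l)⌉₊ * (1 / l),
    (rootValue_self l).sub_nat_mul ((rootValue_self l).portValue hl0) _, ?_, ?_⟩
  · have := Nat.ceil_lt_add_one (div_nonneg (sub_nonneg.mpr h) hi0.le)
    rw [← sub_lt_iff_lt_add, lt_div_iff₀ hi0] at this
    linarith
  · have := Nat.le_ceil ((l - 5 / 2) / (1 / l))
    rw [div_le_iff₀ hi0] at this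
    linarith

theorem RootValue.exists_minEig {l s : ℝ} (h : RootValue l s) (hs : 0 ≤ s) :
    ∃ (n : ℕ) (G : SimpleGraph (Fin n)), 0 < n ∧ minEig (adjMat G) ∈ Set.Icc (-l) (-l + s) := by
  obtain ⟨V, _, G, r, hle, x, hr, hx⟩ := h
  let e := (Fintype.equivFin V).symm
  refine ⟨Fintype.card V, G.comap e, Fintype.card_pos_iff.mpr ⟨r⟩,
    minEig_mem_Icc (x := x ∘ e) (fun y => ?_) (fun h0 => ?_) ?_⟩
  · have h1 := quadForm_comap l e G (y ∘ e.symm)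
    rw [Function.comp_assoc, Equiv.symm_comp_self, Function.comp_id] at h1
    rw [h1]
    exact (by positivity : 0 ≤ s * _ ^ 2).trans (hle _)
  · have := congrFun h0 (e.symm r)
    simp [hr] at this
  · rw [quadForm_comap, hx]
    refine le_mul_of_one_le_right hs ?_
    calc (1 : ℝ) = (x ∘ e) (e.symm r) * (x ∘ e) (e.symm r) := by simp [hr]
      _ ≤ _ := Finset.single_le_sum (f := fun i => (x ∘ e) i * (x ∘ e) i)
        (fun i _ => mul_self_nonneg _) (Finset.mem_univ _)

theorem sqrt_add_inv_sqrt_le {β : ℝ} (hβ : β ^ 3 = β + 1) : √β + (√β)⁻¹ ≤ 21 / 10 := by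
  have hβ1 : 1 < β := by
    by_contra! h
    nlinarith [sq_nonneg (β + 1), sq_nonneg β, sq_nonneg (β - 1)]
  have hβ2 : β ≤ 133 / 100 := by
    by_contra! h
    nlinarith [mul_pos (sub_pos.mpr h) (sub_pos.mpr hβ1), sq_nonneg (β - 1)]
  have hs : 0 < √β := Real.sqrt_pos.mpr (by linarith)
  have hinv : β⁻¹ = β ^ 2 - 1 := by
    refine inv_eq_of_mul_eq_one_right ?_
    linear_combination hβ
  have hsq : (√β + (√β)⁻¹) ^ 2 = β + 2 + β⁻¹ := by
    rw [add_sq, inv_pow, Real.sq_sqrt (by linarith), mul_assoc, mul_inv_cancel₀ hs.ne']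
    ring
  refine abs_le_of_sq_le_sq' ?_ (by norm_num) |>.2
  rw [hsq, hinv]
  nlinarith

/-- For every `λ > λ*` and `ε > 0` there is a graph whose smallest eigenvalue is within `ε`
of `-λ`. -/
theorem smallest_eigenvalues_dense_beyond_lamStar
    (βs lamStar : ℝ) (hβs : βs ^ 3 = βs + 1)
    (hstar : lamStar = Real.sqrt βs + (Real.sqrt βs)⁻¹)
    (lam : ℝ) (hlam : lamStar < lam) (ε : ℝ) (hε : 0 < ε) :
    ∃ (n : ℕ) (G : SimpleGraph (Fin n)), 0 < n ∧ |minEig (adjMat G) - (-lam)| < ε := by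
  subst hstar
  obtain ⟨g, hg, hlo, hhi⟩ := exists_rootValue_le hlam (sqrt_add_inv_sqrt_le hβs)
  obtain ⟨hg2, f, hf, hf0, hf1, hfg⟩ := exists_rootValue_lt_one hβs hg hlo hhi
  obtain ⟨s, hs, hs0, hsε⟩ := exists_rootValue_small hg hf hg2 hhi hf0 hf1 hfg (half_pos hε)
  obtain ⟨n, G, hn, hG⟩ := hs.exists_minEig hs0
  refine ⟨n, G, hn, ?_⟩
  rw [abs_lt]
  constructor <;> linarith [hG.1, hG.2]
end

section
/- For every n ∈ ℕ⁺ and every sequence (a₁, …, a_n) of natural numbers, the smallest eigenvalue of the rowing graph R(a₁, …, a_n) is at least −1 − √2. -/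
open Classical

/-- The rowing graph `R(a₁, …, aₙ)` for `a = [a₁, …, aₙ]`. The central path
`v₋₂ v₋₁ v₀ v₁ ⋯ vₙ` is indexed by `Fin (n + 3)` (index `t` is `v_{t-2}`), the coxswain is
the `Unit` vertex (joined to `v₀`, i.e. index `2`), and for each `i : Fin n` a clique on
`aᵢ₊₁` vertices is joined to `vᵢ` and `vᵢ₊₁` (indices `i + 2` and `i + 3`). -/
def rowingGraph (a : List ℕ) :
    SimpleGraph (Fin (a.length + 3) ⊕ (Unit ⊕ (Σ i : Fin a.length, Fin (a.get i)))) :=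
  SimpleGraph.fromRel fun x y =>
    match x, y with
    | Sum.inl s, Sum.inl t => (t : ℕ) = (s : ℕ) + 1
    | Sum.inr (Sum.inl _), Sum.inl t => (t : ℕ) = 2
    | Sum.inr (Sum.inr p), Sum.inl t => (t : ℕ) = (p.1 : ℕ) + 2 ∨ (t : ℕ) = (p.1 : ℕ) + 3
    | Sum.inr (Sum.inr p), Sum.inr (Sum.inr q) => p.1 = q.1
    | _, _ => False

/-- The smallest eigenvalue of the rowing graph `R(a)`. -/
noncomputable def rowingMinEig (a : List ℕ) : ℝ :=
  minEig (adjMat (rowingGraph a))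

/-- Each clique contributes a square, which controls the negative part of its path edge. -/
lemma sum_clique_form_ge (S G : ℕ → ℝ) (n : ℕ) :
    G 0 ^ 2 + G n ^ 2 ≤
      ∑ i ∈ Finset.range n,
          (S i ^ 2 + 2 * (S i * (G i + G (i + 1))) + 2 * (G i * G (i + 1))) +
        2 * ∑ i ∈ Finset.range (n + 1), G i ^ 2 := by
  induction n with
  | zero => simp; linarith
  | succ n ih =>
    rw [Finset.sum_range_succ, Finset.sum_range_succ _ (n + 1)]
    nlinarith [sq_nonneg (S n + G n + G (n + 1))]

/-- Positivity of the quadratic form of `A + (1 + √2) I` for the rowing graph, where `F` holds the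
values on the central path, `c` the value at the coxswain, `S i` the sum over the `i`-th clique
and `Q` the sum of squares over all cliques. -/
lemma rowing_form_nonneg (F S : ℕ → ℝ) (c Q : ℝ) (hQ : 0 ≤ Q) (n : ℕ) (hF : F (n + 3) = 0) :
    0 ≤ (1 + √2) * (∑ s ∈ Finset.range (n + 3), F s ^ 2 + c ^ 2 + Q) +
      (2 * (∑ s ∈ Finset.range (n + 3), F s * F (s + 1) + c * F 2 +
          ∑ i ∈ Finset.range n, S i * (F (i + 2) + F (i + 3))) +
        (∑ i ∈ Finset.range n, S i ^ 2 - Q)) := by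
  have key := sum_clique_form_ge S (fun i => F (i + 2)) n
  have h0 : F 2 ^ 2 ≤ ∑ i ∈ Finset.range (n + 1), F (i + 2) ^ 2 :=
    Finset.single_le_sum (f := fun i => F (i + 2) ^ 2) (fun i _ => sq_nonneg _) (by simp)
  have e1 : ∑ s ∈ Finset.range (n + 3), F s ^ 2 =
      ∑ i ∈ Finset.range (n + 1), F (i + 2) ^ 2 + F 1 ^ 2 + F 0 ^ 2 := by
    rw [Finset.sum_range_succ', Finset.sum_range_succ']
  have e2 : ∑ s ∈ Finset.range (n + 3), F s * F (s + 1) =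
      ∑ i ∈ Finset.range n, F (i + 2) * F (i + 3) + F 1 * F 2 + F 0 * F 1 := by
    rw [Finset.sum_range_succ, hF, mul_zero, add_zero, Finset.sum_range_succ',
      Finset.sum_range_succ']
  simp only [Finset.sum_add_distrib, ← Finset.mul_sum, zero_add, add_assoc,
    Nat.reduceAdd] at key
  rw [e1, e2]
  have hs : √2 ^ 2 = 2 := Real.sq_sqrt (by norm_num)
  have hs1 : 1 ≤ √2 := Real.one_le_sqrt.mpr (by norm_num)
  have hmul := mul_le_mul_of_nonneg_left h0 (sub_nonneg.mpr hs1)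
  have hQ' : 0 ≤ √2 * Q := by positivity
  have hn := sq_nonneg (F (n + 2))
  have head : 0 ≤ (1 + √2) * (F 0 ^ 2 + F 1 ^ 2 + c ^ 2) + 2 * (F 0 * F 1) + 2 * (F 1 * F 2)
      + 2 * (c * F 2) + √2 * F 2 ^ 2 := by
    have id : (1 + √2) * (F 0 ^ 2 + F 1 ^ 2 + c ^ 2) + 2 * (F 0 * F 1) + 2 * (F 1 * F 2)
      + 2 * (c * F 2) + √2 * F 2 ^ 2 =
        (1 + √2) * (F 0 + (√2 - 1) * F 1) ^ 2 + (1 + √2) * (c + (√2 - 1) * F 2) ^ 2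
          + (2 * F 1 + F 2) ^ 2 / 2 + F 2 ^ 2 / 2 := by
      linear_combination (-(2 * F 0 * F 1) - 2 * c * F 2 + F 1 ^ 2 * (1 - √2)
        + F 2 ^ 2 * (1 - √2)) * hs
    rw [id]; positivity
  nlinarith

/-- The orientation of the edges of the rowing graph incident with the central path. -/
noncomputable def rowingHalf (a : List ℕ) :
    Matrix (Fin (a.length + 3) ⊕ (Unit ⊕ (Σ i : Fin a.length, Fin (a.get i))))
      (Fin (a.length + 3) ⊕ (Unit ⊕ (Σ i : Fin a.length, Fin (a.get i)))) ℝ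
  | Sum.inl s, Sum.inl t => if (t : ℕ) = (s : ℕ) + 1 then 1 else 0
  | Sum.inr (Sum.inl _), Sum.inl t => if (t : ℕ) = 2 then 1 else 0
  | Sum.inr (Sum.inr p), Sum.inl t =>
      (if (t : ℕ) = (p.1 : ℕ) + 2 then 1 else 0) + (if (t : ℕ) = (p.1 : ℕ) + 3 then 1 else 0)
  | _, _ => 0

/-- The adjacency matrix of the disjoint union of the cliques of the rowing graph. -/
noncomputable def rowingCliques (a : List ℕ) :
    Matrix (Fin (a.length + 3) ⊕ (Unit ⊕ (Σ i : Fin a.length, Fin (a.get i))))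
      (Fin (a.length + 3) ⊕ (Unit ⊕ (Σ i : Fin a.length, Fin (a.get i)))) ℝ
  | Sum.inr (Sum.inr p), Sum.inr (Sum.inr q) =>
      (if p.1 = q.1 then 1 else 0) - (if p = q then 1 else 0)
  | _, _ => 0

lemma adjMat_rowingGraph (a : List ℕ) :
    adjMat (rowingGraph a) =
      rowingHalf a + (rowingHalf a).transpose + rowingCliques a := by
  ext p q
  rcases p with s | ⟨⟨⟩ | p⟩ <;> rcases q with t | ⟨⟨⟩ | q⟩ <;>
    simp only [adjMat, rowingGraph, rowingHalf, rowingCliques, SimpleGraph.fromRel_adj,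
      Matrix.add_apply, Matrix.transpose_apply, ne_eq, Sum.inl.injEq, Sum.inr.injEq,
      reduceCtorEq, not_false_eq_true, true_and, or_false, false_or, not_true_eq_false,
      Fin.ext_iff]
  all_goals try (split_ifs <;> first | (norm_num; done) | (exfalso; omega))
  case inr.inl.inr.inl => simp
  case inr.inr.inr.inr =>
    by_cases h : p = q
    · simp [h]
    · simp [h, eq_comm]

lemma sum_fin_ite_eq {m : ℕ} (f : Fin m → ℝ) (k : ℕ) :
    (∑ t : Fin m, if (t : ℕ) = k then f t else 0) = if h : k < m then f ⟨k, h⟩ else 0 := by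
  split_ifs with h
  · rw [Finset.sum_eq_single ⟨k, h⟩] <;> simp +contextual [Fin.ext_iff]
  · exact Finset.sum_eq_zero fun t _ => if_neg (by omega)

lemma rowing_quadratic_nonneg (a : List ℕ)
    (v : (Fin (a.length + 3) ⊕ (Unit ⊕ (Σ i : Fin a.length, Fin (a.get i)))) → ℝ) :
    0 ≤ (1 + √2) * dotProduct v v + dotProduct v ((adjMat (rowingGraph a)).mulVec v) := by
  have hT : dotProduct v ((rowingHalf a).transpose.mulVec v) =
      dotProduct v ((rowingHalf a).mulVec v) := by
    rw [Matrix.mulVec_transpose, dotProduct_comm, Matrix.dotProduct_mulVec]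
  rw [adjMat_rowingGraph, Matrix.add_mulVec, Matrix.add_mulVec, dotProduct_add, dotProduct_add,
    hT, ← two_mul]
  let F : ℕ → ℝ := fun k => if h : k < a.length + 3 then v (Sum.inl ⟨k, h⟩) else 0
  let S : ℕ → ℝ := fun k => if h : k < a.length then
    ∑ j, v (Sum.inr (Sum.inr ⟨⟨k, h⟩, j⟩)) else 0
  have hFv (s : Fin (a.length + 3)) : v (Sum.inl s) = F s := by simp [F]
  have hSv (i : Fin a.length) : ∑ j, v (Sum.inr (Sum.inr ⟨i, j⟩)) = S i := by simp [S]
  have hFs (k : ℕ) : (∑ t : Fin (a.length + 3), if (t : ℕ) = k then F t else 0) = F k := by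
    rw [sum_fin_ite_eq (fun t : Fin (a.length + 3) => F t)]
    by_cases h : k < a.length + 3 <;> simp [F, h]
  have e0 : dotProduct v v = ∑ s ∈ Finset.range (a.length + 3), F s ^ 2 +
      v (Sum.inr (Sum.inl ())) ^ 2 + ∑ p, v (Sum.inr (Sum.inr p)) ^ 2 := by
    simp only [dotProduct, Fintype.sum_sum_type, Finset.univ_unique, Finset.sum_singleton,
      PUnit.default_eq_unit, hFv, ← pow_two, Finset.sum_range, add_assoc]
  have e1 : dotProduct v ((rowingHalf a).mulVec v) =
      ∑ s ∈ Finset.range (a.length + 3), F s * F (s + 1) + v (Sum.inr (Sum.inl ())) * F 2 +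
          ∑ i ∈ Finset.range a.length, S i * (F (i + 2) + F (i + 3)) := by
    simp only [dotProduct, Matrix.mulVec, Fintype.sum_sum_type, Finset.univ_unique,
      Finset.sum_singleton, PUnit.default_eq_unit, hFv, rowingHalf, zero_mul,
      Finset.sum_const_zero, add_zero, ite_mul, one_mul, hFs, add_mul, Finset.sum_add_distrib,
      Finset.sum_range, Fintype.sum_sigma, ← Finset.sum_mul, hSv, add_assoc]
  have e2 : dotProduct v ((rowingCliques a).mulVec v) =
      ∑ i ∈ Finset.range a.length, S i ^ 2 - ∑ p, v (Sum.inr (Sum.inr p)) ^ 2 := by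
    have hS (p : Σ i : Fin a.length, Fin (a.get i)) :
        (∑ q : Σ i : Fin a.length, Fin (a.get i),
          if p.1 = q.1 then v (Sum.inr (Sum.inr q)) else 0) = S p.1 := by
      simp only [Fintype.sum_sigma]
      rw [Finset.sum_eq_single p.1] <;> simp +contextual [hSv, eq_comm]
    simp only [dotProduct, Matrix.mulVec, Fintype.sum_sum_type, rowingCliques, zero_mul,
      Finset.sum_const_zero, zero_add, mul_zero, sub_mul, ite_mul, one_mul,
      Finset.sum_sub_distrib, hS, Finset.sum_ite_eq, Finset.mem_univ, if_true, mul_sub, ← pow_two]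
    congr 1
    rw [Fintype.sum_sigma, Finset.sum_range]
    refine Finset.sum_congr rfl fun i _ => ?_
    dsimp only
    rw [← Finset.sum_mul, hSv, pow_two]
  rw [e0, e1, e2]
  exact rowing_form_nonneg F S _ _ (Finset.sum_nonneg fun p _ => sq_nonneg _) _ (by simp [F])

/-- The smallest eigenvalue of any rowing graph is at least `-1 - √2`. -/
theorem rowing_minEig_ge (a : List ℕ) (ha : 0 < a.length) :
    -1 - Real.sqrt 2 ≤ rowingMinEig a := by
  refine Real.le_sInf ?_ (by linarith [Real.sqrt_nonneg 2])
  rintro μ ⟨v, hv, h⟩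
  have hq := rowing_quadratic_nonneg a v
  rw [h, dotProduct_smul, smul_eq_mul, ← add_mul] at hq
  have hpos : 0 < dotProduct v v :=
    lt_of_le_of_ne (Finset.sum_nonneg fun i _ => mul_self_nonneg _)
      (Ne.symm (dotProduct_self_eq_zero.not.mpr hv))
  linarith [nonneg_of_mul_nonneg_left hq hpos]
end

section
/- There exists a₁ ∈ ℕ such that the rowing graph R(a₁) satisfies λ₁(R(a₁)) < −√(2 + √5). -/
open Classical

theorem bddBelow_setOf_isEigenvalue {V : Type*} [Fintype V] (A : Matrix V V ℝ) :
    BddBelow {μ : ℝ | IsEigenvalue A μ} := by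
  refine Set.Finite.bddBelow ((Module.End.finite_hasEigenvalue (Matrix.mulVecLin A)).subset ?_)
  rintro μ ⟨v, hv, h⟩
  exact Module.End.hasEigenvalue_of_hasEigenvector
    (Module.End.hasEigenvector_iff.2 ⟨Module.End.mem_eigenspace_iff.2 h, hv⟩)

/-- The equitable-partition criterion for eigenvalues of `R(a)`: the values of the vector are
`x, y, z, w` along the central path, `c` on the coxswain and `k` on the clique. -/
theorem isEigenvalue_rowingGraph_singleton (a : ℕ) {μ x y z w c k : ℝ} (hc : c ≠ 0)
    (hx : y = μ * x) (hy : x + z = μ * y) (hz : y + w + c + a * k = μ * z)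
    (hw : z + a * k = μ * w) (hcox : z = μ * c) (hk : z + w + (a - 1) * k = μ * k) :
    IsEigenvalue (adjMat (rowingGraph [a])) μ := by
  let path : Fin 4 → ℝ := ![x, y, z, w]
  refine ⟨Sum.elim path (Sum.elim (fun _ => c) (fun _ => k)), ?_, ?_⟩
  · intro h
    exact hc (congrFun h (Sum.inr (Sum.inl ())))
  · have hsum (g : Fin ([a].length + 3) → ℝ) :
        ∑ i, g i = g (0 : Fin 4) + g (1 : Fin 4) + g (2 : Fin 4) + g (3 : Fin 4) :=
      Fin.sum_univ_four g
    have hclique (g : (Σ i : Fin [a].length, Fin ([a].get i)) → ℝ) :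
        ∑ p, g p = ∑ j : Fin a, g ⟨(0 : Fin 1), j⟩ := by
      rw [Fintype.sum_sigma]
      exact Fin.sum_univ_one _
    have hne (j : Fin a) : ∑ l : Fin a, (if j = l then 0 else k) = (a - 1) * k := by
      have h (l : Fin a) : (if j = l then 0 else k) = k - if j = l then k else 0 := by
        split_ifs <;> simp
      simp [h, Finset.sum_sub_distrib]
      ring
    ext v
    simp only [Matrix.mulVec, dotProduct, Fintype.sum_sum_type, hsum, hclique, adjMat,
      Pi.smul_apply, smul_eq_mul]
    rcases v with i | u | ⟨i, j⟩
    · change Fin 4 at i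
      fin_cases i <;> simp [rowingGraph, path] <;> linarith
    · simp [rowingGraph, path]
      linarith
    · change Fin 1 at i
      fin_cases i
      change Fin a at j
      simp [rowingGraph, path]
      have := hne j
      linarith

/-- There is `a₁` with `λ₁(R(a₁)) < -√(2 + √5)`. -/
theorem rowing_single_below : ∃ a₁ : ℕ,
    rowingMinEig [a₁] < -Real.sqrt (2 + Real.sqrt 5) := by
  let W : ℝ → ℝ := fun t => (t + 1) * (t * (t ^ 2 - 1)) - t ^ 2 - (t ^ 2 - 1)
  let Z : ℝ → ℝ := fun t => t * (t ^ 2 - 1) * (t + 1)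
  let p : ℝ → ℝ := fun t => (t - 99) * (t * W t - Z t) - 100 * (Z t + W t)
  obtain ⟨μ, ⟨-, hμ⟩, hp⟩ : ∃ t ∈ Set.Icc (-2.2 : ℝ) (-2.06), p t = 0 := by
    have hcont : ContinuousOn p (Set.Icc (-2.2 : ℝ) (-2.06)) := by
      apply Continuous.continuousOn
      fun_prop
    exact intermediate_value_Icc' (by norm_num) hcont
      (by constructor <;> norm_num [p, W, Z])
  refine ⟨100, lt_of_le_of_lt (csInf_le (bddBelow_setOf_isEigenvalue _)
    (?_ : IsEigenvalue _ μ)) ?_⟩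
  · refine isEigenvalue_rowingGraph_singleton 100 (x := μ * (μ + 1)) (y := μ ^ 2 * (μ + 1))
      (z := Z μ) (w := W μ) (c := (μ ^ 2 - 1) * (μ + 1)) (k := (μ * W μ - Z μ) / 100)
      ?_ ?_ ?_ ?_ ?_ ?_ ?_
    · exact mul_ne_zero (by nlinarith) (by linarith)
    all_goals simp only [p, W, Z] at hp ⊢
    all_goals push_cast
    all_goals linarith
  · have h5 : Real.sqrt 5 < 2.237 := by
      rw [Real.sqrt_lt' (by norm_num)]
      norm_num
    have h : Real.sqrt (2 + Real.sqrt 5) < 2.06 := by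
      rw [Real.sqrt_lt' (by norm_num)]
      norm_num at h5 ⊢
      linarith
    linarith
end

section
/- Let n ≥ 3, let C_n^± be any signed cycle of length n (the cycle C_n with an arbitrary assignment of signs ±1 to its edges), let A^± be a signed vertex subset consisting of two adjacent vertices of C_n^±, and let ℓ ∈ ℕ. Then inf over m ∈ ℕ⁺ of λ₁((C_n^±, A^±, ℓ, K_m)) is at most −2, and inf over m ∈ ℕ⁺ of λ₁((C_n^±, A^±, K_m)) is at most −2; equivalently, for every ε > 0 there exists m with λ₁((C_n^±, A^±, ℓ, K_m)) < −2 + ε, and likewise for the clique extensions. -/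
open Classical

/-- The signed adjacency matrix of the signed cycle of length `n` whose edge `{i, i+1 mod n}`
has sign `τ i`. -/
noncomputable def signedCycleMat (n : ℕ) (τ : Fin n → ℝ) : Matrix (Fin n) (Fin n) ℝ :=
  fun i j =>
    if (j : ℕ) = ((i : ℕ) + 1) % n then τ i
    else if (i : ℕ) = ((j : ℕ) + 1) % n then τ j else 0

/-- The signed adjacency matrix of the path-clique extension `(Cₙ^±, A^±, ℓ, K_m)`, where the
signed vertex subset `A^±` consists of the adjacent vertices `ua` and `ub` of the signed
cycle, with signs `εa` and `εb`: an all-positive path `v₀ ⋯ v_ℓ` is added, `v₀` joined to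
`ua` (sign `εa`) and `ub` (sign `εb`), and an all-positive clique on `m` new vertices is
joined to `v_ℓ` by positive edges. -/
noncomputable def sCyclePathCliqueExt (n : ℕ) (τ : Fin n → ℝ) (ua ub : Fin n) (εa εb : ℝ)
    (ℓ m : ℕ) :
    Matrix (Fin n ⊕ (Fin (ℓ + 1) ⊕ Fin m)) (Fin n ⊕ (Fin (ℓ + 1) ⊕ Fin m)) ℝ :=
  fun x y =>
    match x, y with
    | Sum.inl i, Sum.inl j => signedCycleMat n τ i j
    | Sum.inl i, Sum.inr (Sum.inl t) =>
        if (t : ℕ) = 0 then (if i = ua then εa else if i = ub then εb else 0) else 0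
    | Sum.inr (Sum.inl t), Sum.inl i =>
        if (t : ℕ) = 0 then (if i = ua then εa else if i = ub then εb else 0) else 0
    | Sum.inr (Sum.inl s), Sum.inr (Sum.inl t) =>
        if (t : ℕ) = (s : ℕ) + 1 ∨ (s : ℕ) = (t : ℕ) + 1 then 1 else 0
    | Sum.inr (Sum.inl t), Sum.inr (Sum.inr _) => if (t : ℕ) = ℓ then 1 else 0
    | Sum.inr (Sum.inr _), Sum.inr (Sum.inl t) => if (t : ℕ) = ℓ then 1 else 0
    | Sum.inr (Sum.inr x), Sum.inr (Sum.inr y) => if x = y then 0 else 1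
    | _, _ => 0

/-- The signed adjacency matrix of the clique extension `(Cₙ^±, A^±, K_m)`: an all-positive
clique on `m` new vertices, each joined to `ua` by an edge of sign `εa` and to `ub` by an
edge of sign `εb`. -/
noncomputable def sCycleCliqueExt (n : ℕ) (τ : Fin n → ℝ) (ua ub : Fin n) (εa εb : ℝ)
    (m : ℕ) : Matrix (Fin n ⊕ Fin m) (Fin n ⊕ Fin m) ℝ :=
  fun x y =>
    match x, y with
    | Sum.inl i, Sum.inl j => signedCycleMat n τ i j
    | Sum.inl i, Sum.inr _ => if i = ua then εa else if i = ub then εb else 0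
    | Sum.inr _, Sum.inl i => if i = ua then εa else if i = ub then εb else 0
    | Sum.inr x, Sum.inr y => if x = y then 0 else 1

open Finset Matrix

theorem minEig_lt_of_dotProduct_lt {V : Type*} [Fintype V] {A : Matrix V V ℝ}
    (hA : A.IsHermitian) {μ : ℝ} (v : V → ℝ) (hv : v ⬝ᵥ (A *ᵥ v) < μ * (v ⬝ᵥ v)) :
    minEig A < μ := by
  have hB : (A - μ • (1 : Matrix V V ℝ)).IsHermitian := by
    refine hA.sub ?_
    rw [Matrix.IsHermitian, conjTranspose_smul, conjTranspose_one, star_trivial]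
  have hex : ∃ i, hB.eigenvalues i < 0 := by
    by_contra! h
    have hpos := hB.posSemidef_iff_eigenvalues_nonneg.2 h
    have := hpos.dotProduct_mulVec_nonneg v
    rw [star_trivial, sub_mulVec, smul_mulVec, one_mulVec, dotProduct_sub, dotProduct_smul,
      smul_eq_mul] at this
    linarith
  obtain ⟨i, hi⟩ := hex
  have hmem : IsEigenvalue A (hB.eigenvalues i + μ) := by
    refine ⟨(hB.eigenvectorBasis i).ofLp, fun h => ?_, ?_⟩
    · exact hB.eigenvectorBasis.orthonormal.ne_zero i (by ext j; simpa using congrFun h j)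
    · have := hB.mulVec_eigenvectorBasis i
      rw [sub_mulVec, smul_mulVec, one_mulVec, sub_eq_iff_eq_add] at this
      rw [this, add_smul]
  have hfin : {ν : ℝ | IsEigenvalue A ν}.Finite := by
    refine (Module.End.finite_hasEigenvalue (Matrix.toLin' A)).subset ?_
    rintro ν ⟨w, hw, hAw⟩
    exact Module.End.hasEigenvalue_of_hasEigenvector (x := w)
      ⟨Module.End.mem_eigenspace_iff.2 (by simpa using hAw), hw⟩
  exact (csInf_le hfin.bddBelow hmem).trans_lt (by linarith)

/-- The cyclic successor of a vertex of the cycle of length `n`. -/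
def cycleNext {n : ℕ} (i : Fin n) : Fin n := ⟨((i : ℕ) + 1) % n, Nat.mod_lt _ i.pos⟩

theorem cycleNext_val {n : ℕ} (i : Fin n) :
    ((cycleNext i : Fin n) : ℕ) = if (i : ℕ) + 1 = n then 0 else (i : ℕ) + 1 := by
  have hi := i.isLt
  unfold cycleNext
  split_ifs with h
  · simp [h]
  · exact Nat.mod_eq_of_lt (by omega)

theorem cycleNext_ne_self {n : ℕ} (hn : 3 ≤ n) (i : Fin n) : cycleNext i ≠ i := by
  intro h
  have h1 := congrArg Fin.val h
  rw [cycleNext_val] at h1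
  split_ifs at h1 <;> omega

theorem cycleNext_cycleNext_ne_self {n : ℕ} (hn : 3 ≤ n) (i : Fin n) :
    cycleNext (cycleNext i) ≠ i := by
  intro h
  have h1 := congrArg Fin.val h
  rw [cycleNext_val, cycleNext_val] at h1
  split_ifs at h1 <;> omega

theorem cycleNext_injective {n : ℕ} : Function.Injective (cycleNext : Fin n → Fin n) := by
  intro i j h
  have h1 := congrArg Fin.val h
  rw [cycleNext_val, cycleNext_val] at h1
  ext
  split_ifs at h1 <;> omega

theorem signedCycleMat_apply {n : ℕ} (hn : 3 ≤ n) (τ : Fin n → ℝ) (i j : Fin n) :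
    signedCycleMat n τ i j =
      (if j = cycleNext i then τ i else 0) + (if i = cycleNext j then τ j else 0) := by
  have e : ∀ i j : Fin n, (j : ℕ) = ((i : ℕ) + 1) % n ↔ j = cycleNext i :=
    fun i j => (Fin.ext_iff (a := j) (b := cycleNext i)).symm
  simp only [signedCycleMat, e]
  split_ifs with h1 h2 h2
  · exact absurd (h1 ▸ h2).symm (cycleNext_cycleNext_ne_self hn i)
  all_goals simp

theorem signedCycleMat_comm {n : ℕ} (hn : 3 ≤ n) (τ : Fin n → ℝ) (i j : Fin n) :
    signedCycleMat n τ i j = signedCycleMat n τ j i := by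
  rw [signedCycleMat_apply hn, signedCycleMat_apply hn, add_comm]

theorem dotProduct_signedCycleMat_mulVec {n : ℕ} (hn : 3 ≤ n) (τ x : Fin n → ℝ) :
    x ⬝ᵥ (signedCycleMat n τ *ᵥ x) = 2 * ∑ i, τ i * x i * x (cycleNext i) := by
  have h1 : ∑ i, ∑ j, x i * ((if j = cycleNext i then τ i else 0) * x j) =
      ∑ i, τ i * x i * x (cycleNext i) := by
    refine sum_congr rfl fun i _ => ?_
    simp only [ite_mul, zero_mul, mul_ite, mul_zero, sum_ite_eq', mem_univ, if_true]
    ring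
  have h2 : ∑ i, ∑ j, x i * ((if i = cycleNext j then τ j else 0) * x j) =
      ∑ i, τ i * x i * x (cycleNext i) := by
    rw [sum_comm, ← h1]
    exact sum_congr rfl fun i _ => sum_congr rfl fun j _ => by split_ifs <;> ring
  simp only [dotProduct, mulVec, signedCycleMat_apply hn, mul_sum, add_mul, mul_add,
    sum_add_distrib] at *
  rw [h1, h2, ← sum_add_distrib]
  exact sum_congr rfl fun i _ => by ring

/-- The edges of a signed cycle other than one given edge can be made negative by switching. -/
theorem exists_switching {n : ℕ} (τ : Fin n → ℝ) (hτ : ∀ i, τ i = 1 ∨ τ i = -1)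
    (a : Fin n) :
    ∃ x : Fin n → ℝ, (∀ i, x i = 1 ∨ x i = -1) ∧
      ∀ i, i ≠ a → τ i * x i * x (cycleNext i) = -1 := by
  have hpos : 0 < n := a.pos
  let b : ℕ := (cycleNext a : Fin n)
  have hb : b = if (a : ℕ) + 1 = n then 0 else (a : ℕ) + 1 := cycleNext_val a
  let z : ℕ → ℝ := fun k => ∏ l ∈ range k, -τ ⟨(b + l) % n, Nat.mod_lt _ hpos⟩
  have hz : ∀ k, z k = 1 ∨ z k = -1 := by
    intro k
    induction k with
    | zero => simp [z]
    | succ k ih =>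
      have : z (k + 1) = z k * -τ ⟨(b + k) % n, Nat.mod_lt _ hpos⟩ := prod_range_succ _ _
      rw [this]
      rcases ih with h | h <;> rcases hτ ⟨(b + k) % n, Nat.mod_lt _ hpos⟩ with h' | h' <;>
        simp [h, h']
  let f : Fin n → ℕ := fun i => if b ≤ i then i - b else i + n - b
  refine ⟨fun i => z (f i), fun i => hz _, fun i hi => ?_⟩
  have hi' : (i : ℕ) ≠ a := fun h => hi (Fin.ext h)
  have hin := i.isLt
  have han := a.isLt
  have hf : f (cycleNext i) = f i + 1 := by
    simp only [f, cycleNext_val]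
    split_ifs at * <;> omega
  have hmod : (⟨(b + f i) % n, Nat.mod_lt _ hpos⟩ : Fin n) = i := by
    ext
    simp only [f]
    split_ifs with h
    · rw [show b + (i - b) = (i : ℕ) by omega, Nat.mod_eq_of_lt hin]
    · rw [show b + (i + n - b) = (i : ℕ) + n by omega, Nat.add_mod_right,
        Nat.mod_eq_of_lt hin]
  have hs : z (f i + 1) = z (f i) * -τ i := by
    have := prod_range_succ (fun l => -τ ⟨(b + l) % n, Nat.mod_lt _ hpos⟩) (f i)
    rwa [hmod] at this
  simp only [hf, hs]
  rcases hz (f i) with h | h <;> rcases hτ i with h' | h' <;> simp [h, h']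

/-- The test vector on the cycle: the form `xᵀAx + 2|x|² - (εa xₐ + εb x_b)²`, to which the
forms of both kinds of extensions reduce for large cliques, is nonpositive at it. -/
theorem exists_cycle_testVector {n : ℕ} (hn : 3 ≤ n) (τ : Fin n → ℝ)
    (hτ : ∀ i, τ i = 1 ∨ τ i = -1) (a : Fin n) {εa εb : ℝ}
    (hεa : εa = 1 ∨ εa = -1) (hεb : εb = 1 ∨ εb = -1) :
    ∃ x : Fin n → ℝ, (εa * x a + εb * x (cycleNext a)) ^ 2 ≤ 4 ∧ 1 ≤ x ⬝ᵥ x ∧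
      x ⬝ᵥ (signedCycleMat n τ *ᵥ x) + 2 * (x ⬝ᵥ x)
        ≤ (εa * x a + εb * x (cycleNext a)) ^ 2 := by
  by_cases hs : τ a = εa * εb
  · obtain ⟨x, hx, hneg⟩ := exists_switching τ hτ a
    have hsq : ∀ i, x i * x i = 1 := fun i => by rcases hx i with h | h <;> simp [h]
    have hnorm : x ⬝ᵥ x = n := by simp [dotProduct, hsq]
    have hsum : ∑ i, τ i * x i * x (cycleNext i) =
        τ a * x a * x (cycleNext a) - (n - 1) := by
      rw [← add_sum_erase _ _ (mem_univ a), sum_congr rfl fun i hi => hneg i (ne_of_mem_erase hi)]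
      simp [card_erase_of_mem, Nat.cast_sub a.pos]
      ring
    have hn' : (3 : ℝ) ≤ n := by exact_mod_cast hn
    refine ⟨x, ?_, by linarith, ?_⟩
    · rcases hx a with h1 | h1 <;> rcases hx (cycleNext a) with h2 | h2 <;>
        rcases hεa with h3 | h3 <;> rcases hεb with h4 | h4 <;> norm_num [h1, h2, h3, h4]
    · rw [dotProduct_signedCycleMat_mulVec hn, hnorm, hsum, hs]
      have ha : εa ^ 2 = 1 := by rcases hεa with h | h <;> simp [h]
      have hb : εb ^ 2 = 1 := by rcases hεb with h | h <;> simp [h]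
      have h1 := hsq a
      have h2 := hsq (cycleNext a)
      have : (εa * x a + εb * x (cycleNext a)) ^ 2 =
          εa ^ 2 * (x a * x a) + εb ^ 2 * (x (cycleNext a) * x (cycleNext a)) +
            2 * (εa * εb * x a * x (cycleNext a)) := by ring
      rw [this, ha, hb, h1, h2]
      linarith
  · have hs' : τ a = -(εa * εb) := by
      rcases hτ a with h | h <;> rcases hεa with h3 | h3 <;> rcases hεb with h4 | h4 <;>
        simp_all
    have hab := cycleNext_ne_self hn a
    let x : Fin n → ℝ := fun i => if i = a then 1 else if i = cycleNext a then εa * εb else 0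
    have hxa : x a = 1 := by simp [x]
    have hxb : x (cycleNext a) = εa * εb := by simp [x, hab]
    have ha : εa * εa = 1 := by rcases hεa with h | h <;> simp [h]
    have hb : εb * εb = 1 := by rcases hεb with h | h <;> simp [h]
    have hnorm : x ⬝ᵥ x = 2 := by
      rw [dotProduct, ← add_sum_erase _ _ (mem_univ a),
        sum_eq_single_of_mem (cycleNext a) (by simp [hab]), hxa, hxb]
      · linear_combination (εb * εb) * ha + hb
      · intro i hi hib
        simp [x, ne_of_mem_erase hi, hib]
    have hsum : ∑ i, τ i * x i * x (cycleNext i) = τ a * x a * x (cycleNext a) := by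
      refine sum_eq_single_of_mem a (mem_univ a) fun i _ hia => ?_
      by_cases hib : i = cycleNext a
      · subst hib
        simp [x, cycleNext_cycleNext_ne_self hn a, cycleNext_ne_self hn (cycleNext a)]
      · simp [x, hia, hib]
    have hs4 : (εa * x a + εb * x (cycleNext a)) ^ 2 = 4 := by
      rw [hxa, hxb]
      linear_combination (1 + εb * εb) ^ 2 * ha + (3 + εb * εb) * hb
    refine ⟨x, hs4.le, by rw [hnorm]; norm_num, ?_⟩
    rw [dotProduct_signedCycleMat_mulVec hn, hsum, hnorm, hs4, hxa, hxb, hs']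
    nlinarith [mul_self_nonneg (εa * εb)]

theorem isHermitian_sCycleCliqueExt {n : ℕ} (hn : 3 ≤ n) (τ : Fin n → ℝ) (ua ub : Fin n)
    (εa εb : ℝ) (m : ℕ) : (sCycleCliqueExt n τ ua ub εa εb m).IsHermitian := by
  refine Matrix.IsHermitian.ext fun x y => ?_
  rcases x with i | x <;> rcases y with j | y <;>
    simp only [sCycleCliqueExt, star_trivial]
  · exact signedCycleMat_comm hn τ j i
  · simp only [eq_comm]

theorem isHermitian_sCyclePathCliqueExt {n : ℕ} (hn : 3 ≤ n) (τ : Fin n → ℝ)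
    (ua ub : Fin n) (εa εb : ℝ) (ℓ m : ℕ) :
    (sCyclePathCliqueExt n τ ua ub εa εb ℓ m).IsHermitian := by
  refine Matrix.IsHermitian.ext fun x y => ?_
  rcases x with i | s | x <;> rcases y with j | t | y <;>
    simp only [sCyclePathCliqueExt, star_trivial]
  · exact signedCycleMat_comm hn τ j i
  · simp only [or_comm]
  · simp only [eq_comm]

theorem sum_mul_pairIndicator {n : ℕ} (x : Fin n → ℝ) {a b : Fin n} (hab : b ≠ a)
    (εa εb : ℝ) :
    ∑ i, x i * (if i = a then εa else if i = b then εb else 0) = εa * x a + εb * x b := by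
  rw [← add_sum_erase _ _ (mem_univ a), sum_eq_single_of_mem b (by simp [hab])]
  · simp [hab]; ring
  · intro i hi hib
    simp [ne_of_mem_erase hi, hib]

theorem sum_completeGraph (m : ℕ) (c : ℝ) :
    ∑ x : Fin m, c * ∑ y : Fin m, (if x = y then 0 else 1) * c = m * (m - 1) * c ^ 2 := by
  have (x : Fin m) : ∑ y : Fin m, (if x = y then (0 : ℝ) else 1) * c = (m - 1) * c := by
    have (y : Fin m) : (if x = y then (0 : ℝ) else 1) * c =
        c - if x = y then c else 0 := by split_ifs <;> ring
    simp only [this, sum_sub_distrib, sum_const, card_univ, Fintype.card_fin, nsmul_eq_mul,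
      sum_ite_eq, mem_univ, if_true]
    ring
  simp only [this, sum_const, card_univ, Fintype.card_fin, nsmul_eq_mul]
  ring

theorem sum_alternating_path (ℓ : ℕ) (y : ℕ → ℝ) (K : ℝ) (hy : ∀ k, y k * y (k + 1) = K) :
    ∑ s : Fin (ℓ + 1), ∑ t : Fin (ℓ + 1),
      y s * ((if (t : ℕ) = (s : ℕ) + 1 ∨ (s : ℕ) = (t : ℕ) + 1 then 1 else 0) * y t) =
      2 * (ℓ * K) := by
  have hterm (s t : ℕ) : y s * ((if t = s + 1 ∨ s = t + 1 then 1 else 0) * y t) =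
      (if t = s + 1 then K else 0) + (if s = t + 1 then K else 0) := by
    have h1 := hy s
    have h2 := hy t
    split_ifs <;> first | omega | (subst_vars; linarith)
  have hcount : ∑ s ∈ range (ℓ + 1), ∑ t ∈ range (ℓ + 1), (if t = s + 1 then K else 0) =
      ℓ * K := by
    rw [sum_range_succ, sum_congr rfl (g := fun _ => K)]
    · simp
    · intro s hs
      rw [sum_ite_eq', if_pos (by simpa using hs)]
  have hcount' := hcount
  rw [sum_comm] at hcount'
  rw [Fin.sum_univ_eq_sum_range (fun s => ∑ t : Fin (ℓ + 1),
    y s * ((if (t : ℕ) = s + 1 ∨ s = (t : ℕ) + 1 then 1 else 0) * y t))]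
  rw [sum_congr rfl fun s _ => Fin.sum_univ_eq_sum_range (fun t =>
    y s * ((if t = s + 1 ∨ s = t + 1 then 1 else 0) * y t)) (ℓ + 1)]
  simp only [hterm, sum_add_distrib, hcount, hcount']
  ring

theorem dotProduct_sCycleCliqueExt {n : ℕ} (τ : Fin n → ℝ) {ua ub : Fin n} (hab : ub ≠ ua)
    (εa εb : ℝ) (m : ℕ) (x : Fin n → ℝ) (c : ℝ) :
    Sum.elim x (fun _ => c) ⬝ᵥ
        (sCycleCliqueExt n τ ua ub εa εb m *ᵥ Sum.elim x fun _ => c) =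
      x ⬝ᵥ (signedCycleMat n τ *ᵥ x) + 2 * (m * c * (εa * x ua + εb * x ub)) +
        m * (m - 1) * c ^ 2 := by
  have h := sum_mul_pairIndicator x hab εa εb
  have h' : ∑ i, (if i = ua then εa else if i = ub then εb else 0) * x i =
      εa * x ua + εb * x ub := by simpa only [mul_comm] using h
  have hK := sum_completeGraph m c
  simp only [dotProduct, mulVec, Fintype.sum_sum_type, Sum.elim_inl, Sum.elim_inr,
    sCycleCliqueExt, mul_add, sum_add_distrib, hK, h', sum_const, card_univ, Fintype.card_fin,
    nsmul_eq_mul]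
  have h2 : ∑ i, x i * ((m : ℝ) * ((if i = ua then εa else if i = ub then εb else 0) * c)) =
      m * c * (εa * x ua + εb * x ub) := by
    rw [← h, mul_sum]
    exact sum_congr rfl fun i _ => by ring
  rw [h2]
  ring

theorem dotProduct_sCyclePathCliqueExt {n : ℕ} (τ : Fin n → ℝ) {ua ub : Fin n}
    (hab : ub ≠ ua) (εa εb : ℝ) (ℓ m : ℕ) (x : Fin n → ℝ) (y : ℕ → ℝ) (K c : ℝ)
    (hy : ∀ k, y k * y (k + 1) = K) :
    Sum.elim x (Sum.elim (fun t : Fin (ℓ + 1) => y t) (fun _ => c)) ⬝ᵥ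
        (sCyclePathCliqueExt n τ ua ub εa εb ℓ m *ᵥ
          Sum.elim x (Sum.elim (fun t : Fin (ℓ + 1) => y t) (fun _ => c))) =
      x ⬝ᵥ (signedCycleMat n τ *ᵥ x) + 2 * (y 0 * (εa * x ua + εb * x ub)) +
        2 * (ℓ * K) + 2 * (m * c * y ℓ) + m * (m - 1) * c ^ 2 := by
  have h := sum_mul_pairIndicator x hab εa εb
  have h' : ∑ i, (if i = ua then εa else if i = ub then εb else 0) * x i =
      εa * x ua + εb * x ub := by simpa only [mul_comm] using h
  have hK := sum_completeGraph m c
  have hP := sum_alternating_path ℓ y K hy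
  have h0 (g : ℕ → ℝ) : ∑ t : Fin (ℓ + 1), (if (t : ℕ) = 0 then g t else 0) = g 0 := by
    rw [Fin.sum_univ_eq_sum_range (fun t => if t = 0 then g t else 0)]
    simp
  have hl (g : ℕ → ℝ) : ∑ t : Fin (ℓ + 1), (if (t : ℕ) = ℓ then g t else 0) = g ℓ := by
    rw [Fin.sum_univ_eq_sum_range (fun t => if t = ℓ then g t else 0)]
    simp
  simp only [← mul_sum] at hP
  simp only [dotProduct, mulVec, Fintype.sum_sum_type, Sum.elim_inl, Sum.elim_inr,
    sCyclePathCliqueExt, mul_add, sum_add_distrib, hK, hP, sum_const, card_univ,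
    Fintype.card_fin, nsmul_eq_mul, zero_mul, mul_zero, add_zero, zero_add]
  have e1 : ∑ i, x i * ∑ t : Fin (ℓ + 1), (if (t : ℕ) = 0 then
      (if i = ua then εa else if i = ub then εb else 0) else 0) * y t =
      y 0 * (εa * x ua + εb * x ub) := by
    rw [← h, mul_sum]
    refine sum_congr rfl fun i _ => ?_
    simp only [ite_mul, zero_mul]
    rw [h0 fun t => if i = ua then εa * y t else if i = ub then εb * y t else 0]
    split_ifs <;> ring
  have e2 : ∑ t : Fin (ℓ + 1), y t * ∑ i, (if (t : ℕ) = 0 then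
      (if i = ua then εa else if i = ub then εb else 0) else 0) * x i =
      y 0 * (εa * x ua + εb * x ub) := by
    rw [← h0 fun t => y t * (εa * x ua + εb * x ub)]
    refine sum_congr rfl fun t _ => ?_
    split_ifs with ht
    · rw [h']
    · simp
  have e3 : ∑ t : Fin (ℓ + 1), y t * ((m : ℝ) * ((if (t : ℕ) = ℓ then 1 else 0) * c)) =
      m * c * y ℓ := by
    rw [← hl fun t => m * c * y t]
    exact sum_congr rfl fun t _ => by split_ifs <;> ring
  have e4 : ∑ t : Fin (ℓ + 1), (if (t : ℕ) = ℓ then 1 else 0) * y t = y ℓ := by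
    rw [← hl y]
    exact sum_congr rfl fun t _ => by split_ifs <;> ring
  rw [e1, e2, e3, e4]
  ring

/-- For any signed cycle `Cₙ^±` (`n ≥ 3`), any signed pair `A^±` of adjacent vertices, and
any `ℓ`, the infimum over `m` of the smallest eigenvalues of the path-clique extensions
`(Cₙ^±, A^±, ℓ, K_m)` and of the clique extensions `(Cₙ^±, A^±, K_m)` is at most `-2`. -/
theorem signed_cycle_extensions (n : ℕ) (hn : 3 ≤ n) (τ : Fin n → ℝ)
    (hτ : ∀ i, τ i = 1 ∨ τ i = -1) (ua ub : Fin n)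
    (hub : (ub : ℕ) = ((ua : ℕ) + 1) % n)
    (εa εb : ℝ) (hεa : εa = 1 ∨ εa = -1) (hεb : εb = 1 ∨ εb = -1) (ℓ : ℕ) :
    (∀ ε : ℝ, 0 < ε → ∃ m : ℕ, 0 < m ∧
        minEig (sCyclePathCliqueExt n τ ua ub εa εb ℓ m) < -2 + ε) ∧
    (∀ ε : ℝ, 0 < ε → ∃ m : ℕ, 0 < m ∧
        minEig (sCycleCliqueExt n τ ua ub εa εb m) < -2 + ε) := by
  have hub' : ub = cycleNext ua := Fin.ext hub
  have hab : ub ≠ ua := hub' ▸ cycleNext_ne_self hn ua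
  obtain ⟨x, hs4, hx1, hx⟩ := exists_cycle_testVector hn τ hτ ua hεa hεb
  rw [← hub'] at hs4 hx
  set s := εa * x ua + εb * x ub with hs
  have key : ∀ ε : ℝ, 0 < ε → ∃ m : ℕ, 0 < m ∧ s ^ 2 / m < ε := by
    intro ε hε
    obtain ⟨m, hm⟩ := exists_nat_gt (4 / ε)
    have hm0 : (0 : ℝ) < m := (by positivity : (0 : ℝ) < 4 / ε).trans hm
    refine ⟨m, by exact_mod_cast hm0, ?_⟩
    rw [div_lt_iff₀ hε] at hm
    rw [div_lt_iff₀ hm0]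
    linarith
  refine ⟨fun ε hε => ?_, fun ε hε => ?_⟩
  · obtain ⟨m, hm, hlt⟩ := key ε hε
    refine ⟨m, hm, ?_⟩
    have hm0 : (m : ℝ) ≠ 0 := by positivity
    let y : ℕ → ℝ := fun k => (-1) ^ (k + 1) * s
    have hyy : ∀ k, y k * y k = s ^ 2 := fun k => by
      simp only [y]
      rw [mul_mul_mul_comm, ← mul_pow]
      norm_num [sq]
    have hy : ∀ k, y k * y (k + 1) = -s ^ 2 := fun k => by
      rw [← hyy k]
      simp only [y]
      ring
    refine minEig_lt_of_dotProduct_lt (isHermitian_sCyclePathCliqueExt hn τ ua ub εa εb ℓ m)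
      (Sum.elim x (Sum.elim (fun t : Fin (ℓ + 1) => y t) (fun _ => -(y ℓ / m)))) ?_
    rw [dotProduct_sCyclePathCliqueExt τ hab εa εb ℓ m x y (-s ^ 2) _ hy, ← hs]
    have hnorm : Sum.elim x (Sum.elim (fun t : Fin (ℓ + 1) => y t)
        (fun _ : Fin m => -(y ℓ / m))) ⬝ᵥ
        Sum.elim x (Sum.elim (fun t : Fin (ℓ + 1) => y t) (fun _ => -(y ℓ / m))) =
        x ⬝ᵥ x + (ℓ + 1) * s ^ 2 + s ^ 2 / m := by
      simp only [dotProduct, Fintype.sum_sum_type, Sum.elim_inl, Sum.elim_inr, hyy, sum_const,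
        card_univ, Fintype.card_fin, nsmul_eq_mul]
      rw [← hyy ℓ]
      push_cast
      field_simp
      ring
    have hform : 2 * (y 0 * s) + 2 * (ℓ * -s ^ 2) + 2 * (m * -(y ℓ / m) * y ℓ) +
        m * (m - 1) * (-(y ℓ / m)) ^ 2 = -(2 * ℓ + 3) * s ^ 2 - s ^ 2 / m := by
      have h0 : y 0 = -s := by simp [y]
      have h1 : (-(y ℓ / m)) ^ 2 = s ^ 2 / m ^ 2 := by rw [← hyy ℓ]; ring
      have h2 : (m : ℝ) * -(y ℓ / m) * y ℓ = -s ^ 2 := by rw [← hyy ℓ]; field_simp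
      rw [h0, h1, h2]
      field_simp
      ring
    rw [hnorm]
    have hN : ε * 1 ≤ ε * (x ⬝ᵥ x + (ℓ + 1) * s ^ 2 + s ^ 2 / m) := by
      gcongr
      have : 0 ≤ (ℓ + 1) * s ^ 2 + s ^ 2 / m := by positivity
      linarith
    linarith
  · obtain ⟨m, hm, hlt⟩ := key ε hε
    refine ⟨m, hm, ?_⟩
    have hm0 : (m : ℝ) ≠ 0 := by positivity
    refine minEig_lt_of_dotProduct_lt (isHermitian_sCycleCliqueExt hn τ ua ub εa εb m)
      (Sum.elim x fun _ => -(s / m)) ?_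
    rw [dotProduct_sCycleCliqueExt τ hab, ← hs]
    have hnorm : (Sum.elim x fun _ : Fin m => -(s / m)) ⬝ᵥ (Sum.elim x fun _ => -(s / m)) =
        x ⬝ᵥ x + s ^ 2 / m := by
      simp only [dotProduct, Fintype.sum_sum_type, Sum.elim_inl, Sum.elim_inr, sum_const,
        card_univ, Fintype.card_fin, nsmul_eq_mul]
      field_simp
    have hform : 2 * (m * -(s / m) * s) + m * (m - 1) * (-(s / m)) ^ 2 =
        -s ^ 2 - s ^ 2 / m := by
      field_simp
      ring
    rw [hnorm]
    have hN : ε * 1 ≤ ε * (x ⬝ᵥ x + s ^ 2 / m) := by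
      gcongr
      have : 0 ≤ s ^ 2 / m := by positivity
      linarith
    linarith
end
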